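/- arXiv:math/0507488 — 5 statements merged into one kernel-verified Lean document; each statement's English description precedes it below -/
import Mathlib

section
/- Let d, n, r, p be integers with 2 ≤ r ≤ d, 0 ≤ p ≤ r−2 and p ≤ min(d,n). Let B be a binary form of order n and let A₁,…,A_r be binary forms of order d over ℂ. Then Γ_p(B; A₁,…,A_r) = 0. -/
open MvPolynomial Finset

/-- The `k`-th transvectant of binary forms `E, F` of orders `e, f`. -/
noncomputable def transvectant (e f k : ℕ) (E F : MvPolynomial (Fin 2) ℂ) :
    MvPolynomial (Fin 2) ℂ :=
  ((((e - k).factorial * (f - k).factorial : ℕ) : ℂ) /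
      ((e.factorial * f.factorial : ℕ) : ℂ)) •
    ∑ i ∈ Finset.range (k + 1),
      ((-1 : ℂ) ^ i * (k.choose i : ℂ)) •
        ((⇑(pderiv (0 : Fin 2)))^[k - i] ((⇑(pderiv (1 : Fin 2)))^[i] E) *
          (⇑(pderiv (0 : Fin 2)))^[i] ((⇑(pderiv (1 : Fin 2)))^[k - i] F))

/-- The Wronskian of `s` binary forms of order `n`. -/
noncomputable def wronskian (n : ℕ) {s : ℕ} (F : Fin s → MvPolynomial (Fin 2) ℂ) :
    MvPolynomial (Fin 2) ℂ :=
  (((n - s + 1).factorial : ℂ) / (n.factorial : ℂ)) ^ s •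
    Matrix.det (Matrix.of fun i j : Fin s =>
      (⇑(pderiv (0 : Fin 2)))^[s - 1 - (j : ℕ)] ((⇑(pderiv (1 : Fin 2)))^[(j : ℕ)] (F i)))

/-- Remove the `i`-th member from a family indexed by `Fin r`. -/
def removeIdx {α : Sort*} {r : ℕ} (A : Fin r → α) (i : Fin r) : Fin (r - 1) → α :=
  fun j => A (Fin.cast (Nat.succ_pred_eq_of_pos i.pos)
    (Fin.succAbove (Fin.cast (Nat.succ_pred_eq_of_pos i.pos).symm i) j))

/-- `Γ_p(B; A₁,…,A_r) = Σᵢ (−1)^{i+1} (B,Aᵢ)_p · W(A₁,…,Âᵢ,…,A_r)`,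
where `B` has order `n` and the `Aᵢ` have order `d`. -/
noncomputable def gammaTransvectant (d n p : ℕ) {r : ℕ}
    (B : MvPolynomial (Fin 2) ℂ) (A : Fin r → MvPolynomial (Fin 2) ℂ) :
    MvPolynomial (Fin 2) ℂ :=
  ∑ i : Fin r, (-1 : ℂ) ^ (i : ℕ) •
    (transvectant n d p B (A i) * wronskian d (removeIdx A i))

/-- The index set `𝒩_r = {q : 0 ≤ q ≤ r, q ≠ 1}`. -/
def Nset (r : ℕ) : Finset ℕ := (Finset.range (r + 1)).filter (· ≠ 1)

/-- A Wronskian-combinant collection for binary forms `A₁,…,A_r` of order `d`: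
forms `C_q` of order `r(d−r+1)−2q` for `q ∈ 𝒩_r` with
`W(A₁,…,A_r,F) = Σ_q (C_q,F)_{r−q}` for all forms `F` of order `d`. -/
def IsWronskianCombinantCollection (d r : ℕ)
    (A : Fin r → MvPolynomial (Fin 2) ℂ) (C : ℕ → MvPolynomial (Fin 2) ℂ) : Prop :=
  (∀ q ∈ Nset r, (C q).IsHomogeneous (r * (d - r + 1) - 2 * q)) ∧
  ∀ F : MvPolynomial (Fin 2) ℂ, F.IsHomogeneous d →
    wronskian d (Fin.snoc A F) =
      ∑ q ∈ Nset r, transvectant (r * (d - r + 1) - 2 * q) d (r - q) (C q) F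


/-- Partial derivatives of multivariate polynomials commute. -/
theorem pderiv_commute {R σ : Type*} [CommRing R] (i j : σ) :
    Function.Commute (⇑(pderiv (R := R) i)) (⇑(pderiv (R := R) j)) := by
  intro f
  have h : ⁅pderiv (R := R) i, pderiv (R := R) j⁆ = 0 := by
    refine MvPolynomial.derivation_ext fun k => ?_
    classical
    simp [Derivation.commutator_apply, pderiv_X, Pi.single_apply, apply_ite]
  have h' := congrArg (fun D => D f) h
  simpa [Derivation.commutator_apply, sub_eq_zero] using h'

theorem isHomogeneous_iterate_pderiv {R σ : Type*} [CommSemiring R] (i : σ) (k : ℕ) {n : ℕ}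
    {F : MvPolynomial σ R} (hF : F.IsHomogeneous n) :
    ((⇑(pderiv i))^[k] F).IsHomogeneous (n - k) := by
  induction k with
  | zero => simpa using hF
  | succ k ih =>
    rw [Function.iterate_succ_apply', Nat.sub_add_eq]
    exact ih.pderiv

/-- Euler's identity for the mixed partial derivatives of a binary form. -/
theorem euler_iterate_pderiv {R : Type*} [CommRing R] {d : ℕ} {F : MvPolynomial (Fin 2) R}
    (hF : F.IsHomogeneous d) (a b : ℕ) :
    (d - b - a) • (⇑(pderiv (0 : Fin 2)))^[a] ((⇑(pderiv (1 : Fin 2)))^[b] F) =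
      X 0 * (⇑(pderiv (0 : Fin 2)))^[a + 1] ((⇑(pderiv (1 : Fin 2)))^[b] F) +
      X 1 * (⇑(pderiv (0 : Fin 2)))^[a] ((⇑(pderiv (1 : Fin 2)))^[b + 1] F) := by
  have h := (isHomogeneous_iterate_pderiv 0 a
    (isHomogeneous_iterate_pderiv 1 b hF)).sum_X_mul_pderiv
  rw [← h, Fin.sum_univ_two, Function.iterate_succ_apply', Function.iterate_succ_apply',
    ((pderiv_commute (R := R) (1 : Fin 2) 0).iterate_right a) _]

/-- The alternating sum of `L (A i)` times the minors of mixed partials of order `m` vanishes for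
every mixed partial derivative `L` of order at most `m`. -/
theorem sum_iterate_pderiv_mul_minor_eq_zero {d m : ℕ} (hmd : m ≤ d)
    (A : Fin (m + 2) → MvPolynomial (Fin 2) ℂ) (hA : ∀ i, (A i).IsHomogeneous d)
    (k a b : ℕ) (hk : a + b + k = m) :
    ∑ i : Fin (m + 2), (-1) ^ (i : ℕ) *
      (⇑(pderiv (0 : Fin 2)))^[a] ((⇑(pderiv (1 : Fin 2)))^[b] (A i)) *
      Matrix.det (Matrix.of fun l j : Fin (m + 1) =>
        (⇑(pderiv (0 : Fin 2)))^[m - j] ((⇑(pderiv (1 : Fin 2)))^[(j : ℕ)]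
          (A (i.succAbove l)))) = 0 := by
  induction k generalizing a b with
  | zero =>
    let M : Matrix (Fin (m + 2)) (Fin (m + 2)) (MvPolynomial (Fin 2) ℂ) :=
      Matrix.of fun i => Fin.cons
        ((⇑(pderiv (0 : Fin 2)))^[a] ((⇑(pderiv (1 : Fin 2)))^[b] (A i)))
        fun j : Fin (m + 1) =>
          (⇑(pderiv (0 : Fin 2)))^[m - j] ((⇑(pderiv (1 : Fin 2)))^[(j : ℕ)] (A i))
    have hM : M.det = 0 := by
      refine Matrix.det_zero_of_column_eq
        (Fin.succ_ne_zero (⟨b, by omega⟩ : Fin (m + 1))).symm fun i => ?_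
      have hab : m - b = a := by omega
      change _ = (⇑(pderiv (0 : Fin 2)))^[m - b] ((⇑(pderiv (1 : Fin 2)))^[b] (A i))
      rw [hab]
      rfl
    rw [Matrix.det_succ_column_zero] at hM
    exact hM
  | succ k ih =>
    have h0 := ih (a + 1) b (by omega)
    have h1 := ih a (b + 1) (by omega)
    have hne : ((d - b - a : ℕ) : MvPolynomial (Fin 2) ℂ) ≠ 0 :=
      Nat.cast_ne_zero.mpr (by omega)
    refine (mul_eq_zero.mp ?_).resolve_left hne
    have hsum := congrArg₂ (fun u v => X 0 * u + X 1 * v) h0 h1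
    simp only [mul_zero, add_zero, mul_sum, ← sum_add_distrib] at hsum
    rw [mul_sum, ← hsum]
    refine sum_congr rfl fun i _ => ?_
    have h := euler_iterate_pderiv (hA i) a b
    rw [nsmul_eq_mul] at h
    linear_combination ((-1) ^ (i : ℕ) * Matrix.det (Matrix.of fun l j : Fin (m + 1) =>
        (⇑(pderiv (0 : Fin 2)))^[m - j] ((⇑(pderiv (1 : Fin 2)))^[(j : ℕ)]
          (A (i.succAbove l))))) * h

/-- for `2 ≤ r ≤ d`, `p ≤ r-2`, `p ≤ min(d,n)`, a binary form `B` of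
order `n` and binary forms `A₁,...,A_r` of order `d`, `Γ_p(B; A₁,...,A_r) = 0`. -/
theorem gamma_eq_zero_of_le_sub_two (d n r p : ℕ) (hr2 : 2 ≤ r) (hrd : r ≤ d)
    (hp : p ≤ r - 2) (hpd : p ≤ d) (hpn : p ≤ n)
    (B : MvPolynomial (Fin 2) ℂ) (hB : B.IsHomogeneous n)
    (A : Fin r → MvPolynomial (Fin 2) ℂ) (hA : ∀ i, (A i).IsHomogeneous d) :
    gammaTransvectant d n p B A = 0 := by
  obtain ⟨m, rfl⟩ := Nat.exists_eq_add_of_le' hr2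
  have hW (i : Fin (m + 2)) : wronskian d (removeIdx A i) =
      (((d - (m + 1) + 1).factorial : ℂ) / (d.factorial : ℂ)) ^ (m + 1) •
        Matrix.det (Matrix.of fun l j : Fin (m + 1) =>
          (⇑(pderiv (0 : Fin 2)))^[m - j] ((⇑(pderiv (1 : Fin 2)))^[(j : ℕ)]
            (A (i.succAbove l)))) := rfl
  simp only [gammaTransvectant, hW, transvectant, smul_mul_assoc, mul_smul_comm, sum_mul,
    smul_sum]
  rw [sum_comm]
  refine sum_eq_zero fun q hq => ?_
  have hqp : q ≤ p := Nat.lt_succ_iff.mp (mem_range.mp hq)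
  have h := sum_iterate_pderiv_mul_minor_eq_zero (by omega) A hA (m - p) q (p - q) (by omega)
  have h' := congrArg (fun u => C ((((n - p).factorial * (d - p).factorial : ℕ) : ℂ) /
      ((n.factorial * d.factorial : ℕ) : ℂ)) *
      C (((d - (m + 1) + 1).factorial : ℂ) / (d.factorial : ℂ)) ^ (m + 1) *
      C ((-1 : ℂ) ^ q * (p.choose q : ℂ)) *
      (⇑(pderiv (0 : Fin 2)))^[p - q] ((⇑(pderiv (1 : Fin 2)))^[q] B) * u) h
  simp only [mul_zero, mul_sum] at h'
  rw [← h']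
  refine sum_congr rfl fun i _ => ?_
  simp only [smul_eq_C_mul, map_pow, map_neg, map_one]
  ring
end

section
/- Let d, n, r be integers with 2 ≤ r ≤ d and r ≤ min(d,n). Let B be a binary form of order n and let A₁,…,A_r be binary forms of order d over ℂ. Then Γ_r(B; A₁,…,A_r) = (−1)^{r−1} · r · (B, W(A₁,…,A_r))_1, where the Wronskian W(A₁,…,A_r) is a binary form of order r(d−r+1). -/
open MvPolynomial Finset

/-- If the columns `1, …, s` of `u` are `x • w₀ + y • w₁, …, x • wₛ₋₁ + y • wₛ`, then the determinant
of `u` with first column `p` is a combination of the determinants of `w` with one column replaced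
by `p`. -/
theorem det_updateCol_zero_of_bidiagonal_of_det_ne_zero {R : Type*} [CommRing R] [IsDomain R]
    {s : ℕ} (w u : Matrix (Fin (s + 1)) (Fin (s + 1)) R) {x y : R} (hy : y ≠ 0)
    (hu : ∀ i (l : Fin s), u i l.succ = x * w i l.castSucc + y * w i l.succ)
    (hw : w.det ≠ 0) (p : Fin (s + 1) → R) :
    (u.updateCol 0 p).det =
      ∑ k : Fin (s + 1), (-x) ^ (k : ℕ) * y ^ (s - (k : ℕ)) * (w.updateCol k p).det := by
  have hcol : ∀ k : Fin (s + 1), u.cramer (w.col k) 0 =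
      (-x) ^ (k : ℕ) * y ^ (s - (k : ℕ)) * w.det := by
    intro k
    induction k using Fin.induction with
    | zero =>
      let U : Matrix (Fin (s + 1)) (Fin (s + 1)) R := Matrix.of fun a => Fin.cons
        (if a = 0 then 1 else 0)
        (fun l => (if a = l.castSucc then x else 0) + (if a = l.succ then y else 0))
      have hU : U.det = y ^ s := by
        rw [Matrix.det_of_isUpperTriangular, Fin.prod_univ_succ]
        · simp [U, Fin.castSucc_lt_succ.ne']
        · intro a b hab
          induction b using Fin.cases with
          | zero =>
            have : a ≠ 0 := hab.ne'
            simp [U, this]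
          | succ l =>
            have h2 : a ≠ l.succ := hab.ne'
            have h1 : a ≠ l.castSucc := (lt_trans (Fin.castSucc_lt_succ) hab).ne'
            simp [U, h1, h2]
      have hprod : u.updateCol 0 (w.col 0) = w * U := by
        ext i b
        induction b using Fin.cases with
        | zero => simp [U, Matrix.mul_apply]
        | succ l =>
          simp [U, Matrix.mul_apply, hu, mul_add, Finset.sum_add_distrib, mul_comm]
      rw [Matrix.cramer_apply, hprod, Matrix.det_mul, hU]
      simp [mul_comm]
    | succ k ih =>
      have hzero : u.cramer (u.col k.succ) 0 = 0 := by
        rw [Matrix.cramer_apply]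
        refine Matrix.det_zero_of_column_eq (i := 0) (j := k.succ) (Fin.succ_ne_zero k).symm ?_
        intro i
        simp
      have hlin : u.col k.succ = x • w.col k.castSucc + y • w.col k.succ := by
        ext i
        simp [hu]
      rw [hlin, map_add, map_smul, map_smul] at hzero
      simp only [Pi.add_apply, Pi.smul_apply, smul_eq_mul, ih] at hzero
      apply mul_left_cancel₀ hy
      have hk : s - (k : ℕ) = (s - (k + 1)) + 1 := by omega
      rw [Fin.val_castSucc, hk] at hzero
      rw [Fin.val_succ]
      linear_combination hzero
  apply mul_left_cancel₀ hw
  have hexp : w.det • p = ∑ k, w.cramer p k • w.col k := by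
    rw [← Matrix.mulVec_cramer, Matrix.mulVec_eq_sum]
    simp only [op_smul_eq_smul]
    rfl
  have happ := congrFun (congrArg u.cramer hexp) 0
  rw [map_smul, map_sum, Finset.sum_apply] at happ
  simp only [map_smul, Pi.smul_apply, smul_eq_mul, hcol] at happ
  simp only [Matrix.cramer_apply] at happ
  rw [happ, Finset.mul_sum]
  exact Finset.sum_congr rfl fun k _ => by ring

theorem det_updateCol_zero_of_bidiagonal {R : Type*} [CommRing R] [IsDomain R]
    {s : ℕ} (w u : Matrix (Fin (s + 1)) (Fin (s + 1)) R) {x y : R} (hy : y ≠ 0)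
    (hu : ∀ i (l : Fin s), u i l.succ = x * w i l.castSucc + y * w i l.succ)
    (p : Fin (s + 1) → R) :
    (u.updateCol 0 p).det =
      ∑ k : Fin (s + 1), (-x) ^ (k : ℕ) * y ^ (s - (k : ℕ)) * (w.updateCol k p).det := by
  let w' := Matrix.charmatrix (-w)
  let u' : Matrix (Fin (s + 1)) (Fin (s + 1)) (Polynomial R) := Matrix.of fun i =>
    Fin.cons 0 (fun l => Polynomial.C x * w' i l.castSucc + Polynomial.C y * w' i l.succ)
  have hw' : ∀ i j, (w' i j).eval 0 = w i j := by
    intro i j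
    by_cases h : i = j
    · subst h
      simp [w', Matrix.charmatrix_apply_eq]
    · simp [w', Matrix.charmatrix_apply_ne _ _ _ h]
  have key := congrArg (Polynomial.evalRingHom 0)
    (det_updateCol_zero_of_bidiagonal_of_det_ne_zero w' u' (x := Polynomial.C x)
      (Polynomial.C_ne_zero.mpr hy) (fun i l => by simp [u'])
      (Matrix.charpoly_monic (-w)).ne_zero (fun i => Polynomial.C (p i)))
  simp only [map_sum, map_mul, map_pow, map_neg, RingHom.map_det] at key
  have hu' : (Polynomial.evalRingHom 0).mapMatrix
      (u'.updateCol 0 fun i => Polynomial.C (p i)) = u.updateCol 0 p := by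
    ext i j
    induction j using Fin.cases with
    | zero => simp
    | succ l => simp [u', hw', hu]
  have hwk : ∀ k, (Polynomial.evalRingHom 0).mapMatrix
      (w'.updateCol k fun i => Polynomial.C (p i)) = w.updateCol k p := by
    intro k
    ext i j
    by_cases h : j = k <;> simp [h, hw']
  simpa [hu', hwk] using key

/-- The determinant of a vector `vₘ` and the consecutive combinations of the columns of `w`, where
the columns of `w` are themselves consecutive combinations of the `vₘ`. -/
theorem det_updateCol_zero_of_bidiagonal_chain {R : Type*} [CommRing R] [IsDomain R]
    {s : ℕ} (w u : Matrix (Fin (s + 1)) (Fin (s + 1)) R) {x y : R} (hy : y ≠ 0)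
    (hu : ∀ i (l : Fin s), u i l.succ = x * w i l.castSucc + y * w i l.succ)
    (v : ℕ → Fin (s + 1) → R) (e : R)
    (hv : ∀ i (m : Fin (s + 1)), x * v m i + y * v (m + 1) i = e * w i m)
    {m : ℕ} (hm : m ≤ s + 1) :
    ((s : R) + 1) * (u.updateCol 0 (v m)).det =
      (-1) ^ m * (((s + 1 - m : ℕ) : R) * x ^ m * y ^ (s - m) *
          (∑ k : Fin (s + 1), (w.updateCol k (v k)).det) -
        (m : R) * x ^ (m - 1) * y ^ (s + 1 - m) *
          (∑ k : Fin (s + 1), (w.updateCol k (v (k + 1))).det)) := by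
  have hvm : ∀ m : Fin (s + 1), x • v m + y • v (m + 1) = e • w.col m := by
    intro m
    ext i
    simpa using hv i m
  have hT : ∀ k m : Fin (s + 1), x * (w.updateCol k (v m)).det +
      y * (w.updateCol k (v (m + 1))).det = if m = k then e * w.det else 0 := by
    intro k m
    have h := congrFun (congrArg w.cramer (hvm m)) k
    simp only [map_add, map_smul, Pi.add_apply, Pi.smul_apply, smul_eq_mul] at h
    simp only [Matrix.cramer_apply] at h
    rw [h]
    split_ifs with hmk
    · subst hmk
      congr 2
      exact Matrix.updateCol_eq_self w m
    · rw [Matrix.det_zero_of_column_eq (Ne.symm hmk), mul_zero]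
      intro i
      simp [hmk]
  have hdiag : ∀ (k : Fin (s + 1)) (j : ℕ), j ≤ k →
      y ^ j * (w.updateCol k (v j)).det = (-x) ^ j * (w.updateCol k (v 0)).det := by
    intro k j hj
    induction j with
    | zero => simp
    | succ j ih =>
      have h := hT k ⟨j, by omega⟩
      rw [if_neg (by simp only [Fin.ext_iff]; omega)] at h
      have ih := ih (by omega)
      simp only at h
      linear_combination y ^ j * h - x * ih
  have heuler : x * (∑ k : Fin (s + 1), (w.updateCol k (v k)).det) +
      y * (∑ k : Fin (s + 1), (w.updateCol k (v (k + 1))).det) = ((s : R) + 1) * (e * w.det) := by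
    rw [Finset.mul_sum, Finset.mul_sum, ← Finset.sum_add_distrib]
    simp [hT]
  induction m with
  | zero =>
    rw [det_updateCol_zero_of_bidiagonal w u hy hu]
    simp only [Nat.cast_zero, pow_zero, Nat.sub_zero, zero_mul, sub_zero, one_mul, mul_one]
    push_cast
    rw [mul_assoc]
    congr 1
    rw [Finset.mul_sum]
    refine Finset.sum_congr rfl fun k _ => ?_
    have hk : y ^ s = y ^ (s - (k : ℕ)) * y ^ (k : ℕ) := by
      rw [← pow_add, Nat.sub_add_cancel (by omega)]
    have h := hdiag k k le_rfl
    rw [hk]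
    linear_combination (- y ^ (s - (k : ℕ))) * h
  | succ m ih =>
    have ih := ih (by omega)
    have hstep : x * (u.updateCol 0 (v m)).det + y * (u.updateCol 0 (v (m + 1))).det =
        (-x) ^ m * y ^ (s - m) * (e * w.det) := by
      simp only [det_updateCol_zero_of_bidiagonal w u hy hu, Finset.mul_sum]
      rw [← Finset.sum_add_distrib, Finset.sum_eq_single (⟨m, by omega⟩ : Fin (s + 1))]
      · have h := hT ⟨m, by omega⟩ ⟨m, by omega⟩
        rw [if_pos rfl] at h
        simp only at h ⊢
        linear_combination (-x) ^ m * y ^ (s - m) * h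
      · intro k _ hk
        have h := hT k ⟨m, by omega⟩
        rw [if_neg hk.symm] at h
        simp only at h
        linear_combination (-x) ^ (k : ℕ) * y ^ (s - (k : ℕ)) * h
      · simp
    apply mul_left_cancel₀ hy
    obtain ⟨t, rfl⟩ : ∃ t, s = m + t := ⟨s - m, by omega⟩
    have e1 : m + t + 1 - (m + 1) = t := by omega
    have e2 : m + t - (m + 1) = t - 1 := by omega
    have e3 : m + t + 1 - m = t + 1 := by omega
    have e4 : m + t - m = t := by omega
    have e5 : m + 1 - 1 = m := by omega
    simp only [e1, e2, e3, e4, e5] at ih hstep ⊢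
    have ht : (t : R) * y ^ (t - 1) * y = t * y ^ t := by
      cases t with
      | zero => simp
      | succ t => simp [pow_succ, mul_assoc]
    have hmx : (m : R) * x ^ (m - 1) * x = m * x ^ m := by
      cases m with
      | zero => simp
      | succ t => simp [pow_succ, mul_assoc]
    have hneg : (-x) ^ m = (-1) ^ m * x ^ m := neg_pow x m
    rw [hneg] at hstep
    push_cast at ih hstep heuler ⊢
    generalize (∑ k : Fin (m + t + 1), (w.updateCol k (v k)).det) = W1 at *
    generalize (∑ k : Fin (m + t + 1), (w.updateCol k (v (k + 1))).det) = W2 at *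
    linear_combination ((m : R) + t + 1) * hstep - x * ih - (-1) ^ m * x ^ m * y ^ t * heuler
      + (-1) ^ m * x ^ (m + 1) * W1 * ht + (-1) ^ m * y ^ (t + 1) * W2 * hmx

theorem Derivation.map_prod_eq_sum_erase {R A ι : Type*} [CommSemiring R] [CommSemiring A]
    [Algebra R A] [DecidableEq ι] (D : Derivation R A A) (s : Finset ι) (f : ι → A) :
    D (∏ i ∈ s, f i) = ∑ k ∈ s, D (f k) * ∏ i ∈ s.erase k, f i := by
  induction s using Finset.induction_on with
  | empty => simp
  | insert a s ha ih =>
    rw [Finset.prod_insert ha, Finset.sum_insert ha, D.leibniz, ih, Finset.erase_insert ha,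
      smul_eq_mul, smul_eq_mul, Finset.mul_sum, add_comm, mul_comm]
    congr 1
    refine Finset.sum_congr rfl fun k hk => ?_
    have hka : a ≠ k := fun h => ha (h ▸ hk)
    rw [Finset.erase_insert_of_ne hka, Finset.prod_insert (by simp [ha])]
    ring

theorem Derivation.map_det_eq_sum_updateCol {R A ι : Type*} [CommRing R] [CommRing A]
    [Algebra R A] [Fintype ι] [DecidableEq ι] (D : Derivation R A A) (M : Matrix ι ι A) :
    D M.det = ∑ k, (M.updateCol k fun i => D (M i k)).det := by
  simp only [Matrix.det_apply', map_sum]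
  rw [Finset.sum_comm]
  refine Finset.sum_congr rfl fun σ _ => ?_
  rw [D.leibniz, D.map_intCast, smul_zero, add_zero, smul_eq_mul, D.map_prod_eq_sum_erase,
    Finset.mul_sum]
  refine Finset.sum_congr rfl fun k _ => ?_
  rw [← Finset.mul_prod_erase Finset.univ _ (Finset.mem_univ k), Matrix.updateCol_self]
  congr 2
  refine Finset.prod_congr rfl fun i hi => ?_
  rw [Matrix.updateCol_ne (Finset.ne_of_mem_erase hi)]

theorem MvPolynomial.pderiv_pderiv_comm {R σ : Type*} [CommRing R] (i j : σ)
    (F : MvPolynomial σ R) : pderiv i (pderiv j F) = pderiv j (pderiv i F) := by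
  classical
  have h : ⁅pderiv (R := R) i, pderiv (R := R) j⁆ = 0 := by
    refine MvPolynomial.derivation_ext fun k => ?_
    rw [Derivation.commutator_apply, pderiv_X, pderiv_X]
    simp only [Pi.single_apply]
    split_ifs <;> simp
  have h' := Derivation.congr_fun h F
  rw [← sub_eq_zero, ← Derivation.commutator_apply]
  exact h'

/-- The mixed partial derivative `∂₀ᵃ ∂₁ᵇ F`. -/
noncomputable def mixedPDeriv (a b : ℕ) (F : MvPolynomial (Fin 2) ℂ) : MvPolynomial (Fin 2) ℂ :=
  (⇑(pderiv (0 : Fin 2)))^[a] ((⇑(pderiv (1 : Fin 2)))^[b] F)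

theorem pderiv_zero_mixedPDeriv (a b : ℕ) (F : MvPolynomial (Fin 2) ℂ) :
    pderiv 0 (mixedPDeriv a b F) = mixedPDeriv (a + 1) b F :=
  (Function.iterate_succ_apply' _ _ _).symm

theorem pderiv_one_mixedPDeriv (a b : ℕ) (F : MvPolynomial (Fin 2) ℂ) :
    pderiv 1 (mixedPDeriv a b F) = mixedPDeriv a (b + 1) F := by
  have h : Function.Commute (⇑(pderiv (R := ℂ) (1 : Fin 2))) (⇑(pderiv (0 : Fin 2))) :=
    fun F => pderiv_pderiv_comm 1 0 F
  rw [mixedPDeriv, mixedPDeriv, (h.iterate_right a) _, Function.iterate_succ_apply']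

theorem mixedPDeriv_pderiv_zero (a b : ℕ) (F : MvPolynomial (Fin 2) ℂ) :
    mixedPDeriv a b (pderiv 0 F) = mixedPDeriv (a + 1) b F := by
  have h : Function.Commute (⇑(pderiv (R := ℂ) (0 : Fin 2))) (⇑(pderiv (1 : Fin 2))) :=
    fun F => pderiv_pderiv_comm 0 1 F
  rw [mixedPDeriv, mixedPDeriv, ← (h.iterate_right b) _, Function.iterate_succ_apply]

theorem mixedPDeriv_pderiv_one (a b : ℕ) (F : MvPolynomial (Fin 2) ℂ) :
    mixedPDeriv a b (pderiv 1 F) = mixedPDeriv a (b + 1) F := by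
  rw [mixedPDeriv, mixedPDeriv, Function.iterate_succ_apply]

theorem isHomogeneous_mixedPDeriv {n : ℕ} {F : MvPolynomial (Fin 2) ℂ} (hF : F.IsHomogeneous n)
    (a b : ℕ) : (mixedPDeriv a b F).IsHomogeneous (n - (a + b)) := by
  induction a with
  | zero =>
    induction b with
    | zero => simpa [mixedPDeriv] using hF
    | succ b ih =>
      rw [← pderiv_one_mixedPDeriv]
      convert ih.pderiv using 1
      omega
  | succ a ih =>
    rw [← pderiv_zero_mixedPDeriv]
    convert ih.pderiv using 1
    omega

theorem euler_mixedPDeriv {n : ℕ} {F : MvPolynomial (Fin 2) ℂ} (hF : F.IsHomogeneous n)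
    (a b : ℕ) : X 0 * mixedPDeriv (a + 1) b F + X 1 * mixedPDeriv a (b + 1) F =
      ((n - (a + b) : ℕ) : MvPolynomial (Fin 2) ℂ) * mixedPDeriv a b F := by
  have h := (isHomogeneous_mixedPDeriv hF a b).sum_X_mul_pderiv
  rwa [Fin.sum_univ_two, pderiv_zero_mixedPDeriv, pderiv_one_mixedPDeriv, nsmul_eq_mul] at h

theorem sum_antidiagonal_choose_mixedPDeriv {n : ℕ} {F : MvPolynomial (Fin 2) ℂ}
    (hF : F.IsHomogeneous n) (q : ℕ) :
    ∑ ij ∈ antidiagonal q, q.choose ij.1 •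
        (X 0 ^ ij.1 * X 1 ^ ij.2 * mixedPDeriv ij.1 ij.2 F) = n.descFactorial q • F := by
  induction q generalizing n F with
  | zero => simp [mixedPDeriv]
  | succ q ih =>
    rw [Finset.sum_antidiagonal_choose_succ_nsmul
      (fun i j => X 0 ^ i * X 1 ^ j * mixedPDeriv i j F)]
    have h0 := congrArg (X 0 * ·) (ih (hF.pderiv (i := 0)))
    have h1 := congrArg (X 1 * ·) (ih (hF.pderiv (i := 1)))
    simp only [mixedPDeriv_pderiv_zero, mixedPDeriv_pderiv_one, Finset.mul_sum] at h0 h1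
    have he := hF.sum_X_mul_pderiv
    rw [Fin.sum_univ_two] at he
    have hd : n.descFactorial (q + 1) = (n - 1).descFactorial q * n := by
      cases n with
      | zero => simp
      | succ n => rw [Nat.succ_descFactorial_succ, Nat.add_sub_cancel, mul_comm]
    rw [hd, mul_smul, ← he, smul_add, ← mul_smul_comm, ← mul_smul_comm, ← h0, ← h1, add_comm]
    congr 1
    · refine Finset.sum_congr rfl fun ij hij => ?_
      rw [Nat.choose_symm_of_eq_add (mem_antidiagonal.mp hij).symm]
      simp only [nsmul_eq_mul, pow_succ]
      ring
    · refine Finset.sum_congr rfl fun ij hij => ?_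
      simp only [nsmul_eq_mul, pow_succ]
      ring

theorem sum_range_choose_mixedPDeriv {n : ℕ} {F : MvPolynomial (Fin 2) ℂ}
    (hF : F.IsHomogeneous n) (q : ℕ) :
    ∑ j ∈ range (q + 1), (q.choose j : MvPolynomial (Fin 2) ℂ) *
        (X 0 ^ (q - j) * X 1 ^ j * mixedPDeriv (q - j) j F) =
      (n.descFactorial q : MvPolynomial (Fin 2) ℂ) * F := by
  rw [← nsmul_eq_mul, ← sum_antidiagonal_choose_mixedPDeriv hF, ← Finset.Nat.sum_antidiagonal_swap,
    Finset.Nat.sum_antidiagonal_eq_sum_range_succ_mk]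
  refine Finset.sum_congr rfl fun j hj => ?_
  rw [nsmul_eq_mul]
  simp only [Prod.swap]
  rw [Nat.choose_symm (by simpa [Nat.lt_succ_iff] using hj)]

/-- Splitting an alternating binomial sum of order `s + 1` into two of order `s`. -/
theorem sum_range_choose_succ_split {R : Type*} [CommRing R] (s : ℕ) (x y W₁ W₂ : R)
    (β : ℕ → R) :
    ∑ j ∈ range (s + 1 + 1), (-1) ^ j * ((s + 1).choose j : R) * β j *
        ((-1) ^ (s + 1 - j) * ((j : R) * x ^ (s + 1 - j) * y ^ (j - 1) * W₁ -
          ((s + 1 - j : ℕ) : R) * x ^ (s - j) * y ^ j * W₂)) =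
      ((s : R) + 1) * ((-1) ^ s *
        ((∑ j ∈ range (s + 1), (s.choose j : R) * (x ^ (s - j) * y ^ j * β j)) * W₂ -
          (∑ j ∈ range (s + 1), (s.choose j : R) * (x ^ (s - j) * y ^ j * β (j + 1))) * W₁)) := by
  have h1 : ∑ j ∈ range (s + 1 + 1), ((s + 1).choose j : R) * β j *
      ((j : R) * x ^ (s + 1 - j) * y ^ (j - 1)) =
      ((s : R) + 1) *
        ∑ j ∈ range (s + 1), (s.choose j : R) * (x ^ (s - j) * y ^ j * β (j + 1)) := by
    rw [Finset.sum_range_succ', Finset.mul_sum]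
    simp only [Nat.cast_zero, zero_mul, mul_zero, add_zero]
    refine Finset.sum_congr rfl fun j _ => ?_
    have h : ((s + 1 : ℕ) : R) * s.choose j = (s + 1).choose (j + 1) * (j + 1 : ℕ) := by
      exact_mod_cast congrArg (Nat.cast : ℕ → R) (Nat.add_one_mul_choose_eq s j)
    rw [Nat.add_sub_cancel, Nat.add_sub_add_right]
    push_cast at h ⊢
    linear_combination (- x ^ (s - j) * y ^ j * β (j + 1)) * h
  have h2 : ∑ j ∈ range (s + 1 + 1), ((s + 1).choose j : R) * β j *
      (((s + 1 - j : ℕ) : R) * x ^ (s - j) * y ^ j) =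
      ((s : R) + 1) *
        ∑ j ∈ range (s + 1), (s.choose j : R) * (x ^ (s - j) * y ^ j * β j) := by
    rw [Finset.sum_range_succ, Finset.mul_sum]
    simp only [Nat.sub_self, Nat.cast_zero, zero_mul, mul_zero, add_zero]
    refine Finset.sum_congr rfl fun j _ => ?_
    have h : (s.choose j : R) * (s + 1 : ℕ) = (s + 1).choose j * (s + 1 - j : ℕ) := by
      exact_mod_cast congrArg (Nat.cast : ℕ → R) (Nat.choose_mul_succ_eq s j)
    push_cast at h ⊢
    linear_combination (- x ^ (s - j) * y ^ j * β j) * h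
  have hsign : ∀ j ∈ range (s + 1 + 1), (-1 : R) ^ j * (-1) ^ (s + 1 - j) = -(-1) ^ s := by
    intro j hj
    rw [← pow_add, Nat.add_sub_cancel' (by simpa [Nat.lt_succ_iff] using hj), pow_succ]
    ring
  calc _ = ∑ j ∈ range (s + 1 + 1), -(-1) ^ s *
          (((s + 1).choose j : R) * β j * ((j : R) * x ^ (s + 1 - j) * y ^ (j - 1)) * W₁ -
          ((s + 1).choose j : R) * β j *
            (((s + 1 - j : ℕ) : R) * x ^ (s - j) * y ^ j) * W₂) := by
        refine Finset.sum_congr rfl fun j hj => ?_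
        rw [← hsign j hj]
        ring
    _ = _ := by
        rw [← Finset.mul_sum, Finset.sum_sub_distrib, ← Finset.sum_mul, ← Finset.sum_mul, h1, h2]
        ring

theorem factorial_coefficient_eq {d n s : ℕ} (hd : s + 1 ≤ d) (hn : s + 1 ≤ n) :
    ((((n - (s + 1)).factorial * (d - (s + 1)).factorial : ℕ) : ℂ) /
        ((n.factorial * d.factorial : ℕ) : ℂ)) *
        (((d - s).factorial : ℂ) / d.factorial) ^ s * ((n - 1).descFactorial s : ℂ) =
      ((s : ℂ) + 1) * (((((n - 1).factorial * ((s + 1) * (d - s) - 1).factorial : ℕ) : ℂ) /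
        ((n.factorial * ((s + 1) * (d - s)).factorial : ℕ) : ℂ)) *
        (((d - s).factorial : ℂ) / d.factorial) ^ (s + 1)) := by
  obtain ⟨a, rfl⟩ := Nat.exists_eq_add_of_le hd
  obtain ⟨b, rfl⟩ := Nat.exists_eq_add_of_le hn
  have e1 : s + 1 + a - s = a + 1 := by omega
  have e2 : s + 1 + b - 1 = s + b := by omega
  have hdf : (b.factorial : ℂ) * ((s + b).descFactorial s : ℂ) = (s + b).factorial := by
    have h := Nat.factorial_mul_descFactorial (Nat.le_add_right s b)
    rw [Nat.add_sub_cancel_left] at h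
    exact_mod_cast h
  have hN : (((s + 1) * (a + 1)).factorial : ℂ) =
      ((s : ℂ) + 1) * (a + 1) * ((s + 1) * (a + 1) - 1).factorial := by
    have h := Nat.mul_factorial_pred (n := (s + 1) * (a + 1)) (by positivity)
    exact_mod_cast h.symm
  have hn0 : ((s + 1 + b).factorial : ℂ) ≠ 0 := by exact_mod_cast Nat.factorial_ne_zero _
  have hd0 : ((s + 1 + a).factorial : ℂ) ≠ 0 := by exact_mod_cast Nat.factorial_ne_zero _
  have hN0 : (((s + 1) * (a + 1) - 1).factorial : ℂ) ≠ 0 := by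
    exact_mod_cast Nat.factorial_ne_zero _
  have hs0 : (s : ℂ) + 1 ≠ 0 := by exact_mod_cast Nat.succ_ne_zero s
  have ha0 : (a : ℂ) + 1 ≠ 0 := by exact_mod_cast Nat.succ_ne_zero a
  rw [e1, e2, Nat.add_sub_cancel_left, Nat.add_sub_cancel_left, Nat.factorial_succ a]
  push_cast
  rw [hN, ← hdf, pow_succ _ s]
  generalize ((((a : ℂ) + 1) * a.factorial) / (s + 1 + a).factorial) ^ s = t
  field_simp

/-- for `2 ≤ r ≤ d`, `r ≤ min(d,n)`, a binary form `B` of order `n`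
and binary forms `A₁,...,A_r` of order `d`,
`Γ_r(B; A₁,...,A_r) = (-1)^(r-1) * r * (B, W(A₁,...,A_r))_1`, the Wronskian being a
binary form of order `r(d-r+1)`. -/
theorem gamma_eq_transvectant_wronskian (d n r : ℕ) (hr2 : 2 ≤ r) (hrd : r ≤ d)
    (hn : r ≤ n)
    (B : MvPolynomial (Fin 2) ℂ) (hB : B.IsHomogeneous n)
    (A : Fin r → MvPolynomial (Fin 2) ℂ) (hA : ∀ i, (A i).IsHomogeneous d) :
    gammaTransvectant d n r B A =
      ((-1 : ℂ) ^ (r - 1) * (r : ℂ)) •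
        transvectant n (r * (d - r + 1)) 1 B (wronskian d A) := by
  obtain ⟨s, rfl⟩ : ∃ s, r = s + 1 := ⟨r - 1, by omega⟩
  let w : Matrix (Fin (s + 1)) (Fin (s + 1)) (MvPolynomial (Fin 2) ℂ) :=
    Matrix.of fun i j => mixedPDeriv (s - j) j (A i)
  let u : Matrix (Fin (s + 1)) (Fin (s + 1)) (MvPolynomial (Fin 2) ℂ) :=
    Matrix.of fun i => Fin.cons 0
      (fun l : Fin s => X 0 * w i l.castSucc + X 1 * w i l.succ)
  let v : ℕ → Fin (s + 1) → MvPolynomial (Fin 2) ℂ := fun m i => mixedPDeriv (s + 1 - m) m (A i)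
  let c : ℂ := ((d - s).factorial : ℂ) / d.factorial
  have hv : ∀ i (m : Fin (s + 1)), X 0 * v m i + X 1 * v (m + 1) i =
      ((d - s : ℕ) : MvPolynomial (Fin 2) ℂ) * w i m := by
    intro i m
    have h := euler_mixedPDeriv (hA i) (s - m) m
    rw [show s - (m : ℕ) + 1 = s + 1 - m by omega, show s - (m : ℕ) + m = s by omega] at h
    simpa only [v, w, Matrix.of_apply, Nat.add_sub_add_right] using h
  have hu : ∀ i (l : Fin s), u i l.succ =
      ((d - s + 1 : ℕ) : ℂ) • mixedPDeriv (s - 1 - l) l (A i) := by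
    intro i l
    have h := euler_mixedPDeriv (hA i) (s - 1 - l) l
    rw [show s - 1 - (l : ℕ) + 1 = s - l by omega,
      show d - (s - 1 - (l : ℕ) + l) = d - s + 1 by omega] at h
    rw [Nat.cast_smul_eq_nsmul, nsmul_eq_mul, ← h]
    simp only [u, w, Matrix.of_apply, Fin.cons_succ, Fin.val_castSucc, Fin.val_succ]
    rw [show s - ((l : ℕ) + 1) = s - 1 - l by omega]
  have hwron : wronskian d A = c ^ (s + 1) • w.det := by
    rw [wronskian, show d - (s + 1) + 1 = d - s by omega]
    rfl
  have hminor : ∀ i : Fin (s + 1), wronskian d (removeIdx A i) =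
      c ^ s • (u.submatrix i.succAbove Fin.succ).det := by
    intro i
    have hsub : u.submatrix i.succAbove Fin.succ = ((d - s + 1 : ℕ) : ℂ) •
        Matrix.of fun k l : Fin s => mixedPDeriv (s - 1 - l) l (A (i.succAbove k)) := by
      ext1 k l
      exact hu _ _
    rw [hsub, Matrix.det_smul_of_tower, Fintype.card_fin, smul_smul, ← mul_pow,
      show c * ((d - s + 1 : ℕ) : ℂ) = ((d - s + 1).factorial : ℂ) / d.factorial by
        rw [Nat.factorial_succ]; push_cast; ring]
    rfl
  have hlaplace : ∀ m, ∑ i : Fin (s + 1), (-1 : ℂ) ^ (i : ℕ) •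
      (v m i * wronskian d (removeIdx A i)) = c ^ s • (u.updateCol 0 (v m)).det := by
    intro m
    rw [Matrix.det_succ_column_zero, Finset.smul_sum]
    refine Finset.sum_congr rfl fun i _ => ?_
    rw [hminor, Matrix.updateCol_self, mul_smul_comm, smul_comm]
    congr 1
    have hsub : (u.updateCol 0 (v m)).submatrix i.succAbove Fin.succ =
        u.submatrix i.succAbove Fin.succ := by
      ext k l
      simp
    rw [hsub, MvPolynomial.smul_eq_C_mul]
    simp [mul_assoc]
  have hW₁ : pderiv 0 w.det = ∑ k : Fin (s + 1), (w.updateCol k (v k)).det := by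
    rw [Derivation.map_det_eq_sum_updateCol]
    refine Finset.sum_congr rfl fun k _ => ?_
    congr 2
    ext1 i
    change pderiv 0 (mixedPDeriv (s - k) k (A i)) = mixedPDeriv (s + 1 - k) k (A i)
    rw [pderiv_zero_mixedPDeriv, ← Nat.sub_add_comm (by omega)]
  have hW₂ : pderiv 1 w.det = ∑ k : Fin (s + 1), (w.updateCol k (v (k + 1))).det := by
    rw [Derivation.map_det_eq_sum_updateCol]
    refine Finset.sum_congr rfl fun k _ => ?_
    congr 2
    ext1 i
    change pderiv 1 (mixedPDeriv (s - k) k (A i)) = mixedPDeriv (s + 1 - (k + 1)) (k + 1) (A i)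
    rw [pderiv_one_mixedPDeriv, Nat.add_sub_add_right]
  have hchain := fun m hm => det_updateCol_zero_of_bidiagonal_chain w u
    (X_ne_zero (R := ℂ) (1 : Fin 2)) (fun _ _ => rfl) v _ hv (m := m) hm
  have hsum : ∑ j ∈ range (s + 1 + 1), (-1 : MvPolynomial (Fin 2) ℂ) ^ j *
      ((s + 1).choose j : MvPolynomial (Fin 2) ℂ) * mixedPDeriv (s + 1 - j) j B *
        (u.updateCol 0 (v (s + 1 - j))).det =
      (-1) ^ s * (((n - 1).descFactorial s : MvPolynomial (Fin 2) ℂ) *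
        (pderiv 0 B * pderiv 1 w.det - pderiv 1 B * pderiv 0 w.det)) := by
    have hs : (s : MvPolynomial (Fin 2) ℂ) + 1 ≠ 0 := by exact_mod_cast Nat.succ_ne_zero s
    apply mul_left_cancel₀ hs
    have h0 := sum_range_choose_mixedPDeriv (hB.pderiv (i := 0)) s
    have h1 := sum_range_choose_mixedPDeriv (hB.pderiv (i := 1)) s
    simp only [mixedPDeriv_pderiv_zero, mixedPDeriv_pderiv_one] at h0 h1
    have h0' : ∀ j ∈ range (s + 1), (s.choose j : MvPolynomial (Fin 2) ℂ) *
        (X 0 ^ (s - j) * X 1 ^ j * mixedPDeriv (s - j + 1) j B) =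
        (s.choose j : MvPolynomial (Fin 2) ℂ) *
        (X 0 ^ (s - j) * X 1 ^ j * mixedPDeriv (s + 1 - j) j B) := by
      intro j hj
      rw [← Nat.sub_add_comm (by simpa [Nat.lt_succ_iff] using hj)]
    have hsplit := sum_range_choose_succ_split s (X 0) (X 1) (pderiv 0 w.det) (pderiv 1 w.det)
      (fun j => mixedPDeriv (s + 1 - j) j B)
    simp only [Nat.add_sub_add_right] at hsplit
    rw [← Finset.sum_congr rfl h0', h0, h1] at hsplit
    rw [mul_sub, ← mul_assoc _ (pderiv 0 B), ← mul_assoc _ (pderiv 1 B), ← hsplit,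
      Finset.mul_sum]
    refine Finset.sum_congr rfl fun j hj => ?_
    have hj' : j ≤ s + 1 := by simpa [Nat.lt_succ_iff] using hj
    have h := hchain (s + 1 - j) (by omega)
    rw [← hW₁, ← hW₂, Nat.sub_sub_self hj', show s - (s + 1 - j) = j - 1 by omega,
      show s + 1 - j - 1 = s - j by omega] at h
    linear_combination (-1) ^ j * ((s + 1).choose j : MvPolynomial (Fin 2) ℂ) *
      mixedPDeriv (s + 1 - j) j B * h
  have hgamma : gammaTransvectant d n (s + 1) B A =
      (((((n - (s + 1)).factorial * (d - (s + 1)).factorial : ℕ) : ℂ) /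
        ((n.factorial * d.factorial : ℕ) : ℂ)) * c ^ s) •
      ∑ j ∈ range (s + 1 + 1), (-1 : MvPolynomial (Fin 2) ℂ) ^ j *
        ((s + 1).choose j : MvPolynomial (Fin 2) ℂ) * mixedPDeriv (s + 1 - j) j B *
          (u.updateCol 0 (v (s + 1 - j))).det := by
    simp only [gammaTransvectant, transvectant]
    simp only [smul_mul_assoc, smul_comm _ (_ / _ : ℂ)]
    rw [← Finset.smul_sum, mul_smul]
    congr 1
    simp only [Finset.sum_mul, Finset.smul_sum]
    rw [Finset.sum_comm]
    refine Finset.sum_congr rfl fun j hj => ?_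
    have hj' : j ≤ s + 1 := by simpa [Nat.lt_succ_iff] using hj
    rw [← mul_smul_comm, ← hlaplace, Finset.mul_sum]
    refine Finset.sum_congr rfl fun i _ => ?_
    simp only [v, Nat.sub_sub_self hj', MvPolynomial.smul_eq_C_mul, mixedPDeriv, map_mul,
      map_pow, map_neg, map_one, map_natCast]
    ring
  have htrans : transvectant n ((s + 1) * (d - s)) 1 B w.det =
      ((((n - 1).factorial * ((s + 1) * (d - s) - 1).factorial : ℕ) : ℂ) /
        ((n.factorial * ((s + 1) * (d - s)).factorial : ℕ) : ℂ)) •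
      (pderiv 0 B * pderiv 1 w.det - pderiv 1 B * pderiv 0 w.det) := by
    rw [transvectant]
    congr 1
    simp [Finset.sum_range_succ, sub_eq_add_neg]
  have htsmul : ∀ (a : ℂ) (e f k : ℕ) (E F : MvPolynomial (Fin 2) ℂ), k = 1 →
      transvectant e f k E (a • F) = a • transvectant e f k E F := by
    rintro a e f k E F rfl
    simp [transvectant, Finset.sum_range_succ, smul_comm a, ← smul_add, ← smul_neg]
  rw [hgamma, hsum, hwron, htsmul _ _ _ _ _ _ rfl, show d - (s + 1) + 1 = d - s by omega, htrans,
    smul_smul, smul_smul, Nat.add_sub_cancel]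
  have hc := factorial_coefficient_eq hrd hn
  have hcast : (-1 : MvPolynomial (Fin 2) ℂ) ^ s *
      (((n - 1).descFactorial s : MvPolynomial (Fin 2) ℂ) *
        (pderiv 0 B * pderiv 1 w.det - pderiv 1 B * pderiv 0 w.det)) =
      ((-1 : ℂ) ^ s * ((n - 1).descFactorial s : ℂ)) •
        (pderiv 0 B * pderiv 1 w.det - pderiv 1 B * pderiv 0 w.det) := by
    simp [MvPolynomial.smul_eq_C_mul, mul_assoc]
  rw [hcast, smul_smul]
  congr 1
  push_cast at hc ⊢
  linear_combination (-1) ^ s * hc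
end

section
/- Let d, r be integers with 2 ≤ r ≤ d−1 and let A₁,…,A_r be binary forms of order d over ℂ. Then there exists a Wronskian-combinant collection for (A₁,…,A_r); that is, there exist binary forms C_q of order r(d−r+1)−2q for each q ∈ 𝒩_r = {q : 0 ≤ q ≤ r, q ≠ 1} such that W(A₁,…,A_r,F) = Σ_{q∈𝒩_r} (C_q,F)_{r−q} for every binary form F of order d. -/
open MvPolynomial Finset

/-- The partial derivative `∂ᵢ` as a `ℂ`-linear endomorphism of the ring of binary forms. -/
noncomputable def pderivEnd (i : Fin 2) : Module.End ℂ (MvPolynomial (Fin 2) ℂ) :=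
  (pderiv i).toLinearMap

/-- The directional derivative `s ∂₁ - ∂₂`, which annihilates the linear form `x₁ + s x₂`. -/
noncomputable def directional (s : ℂ) : Module.End ℂ (MvPolynomial (Fin 2) ℂ) :=
  s • pderivEnd 0 - pderivEnd 1

/-- The linear form `x₁ + s x₂`. -/
noncomputable def linearForm (s : ℂ) : MvPolynomial (Fin 2) ℂ := X 0 + s • X 1

/-- The homogenization of `∑ j, P j * y ^ j` in degree `k`, evaluated at `(-x₁, x₂)`. -/
noncomputable def homEval (k : ℕ) (P : ℕ → MvPolynomial (Fin 2) ℂ) : MvPolynomial (Fin 2) ℂ :=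
  ∑ j ∈ range (k + 1), P j * ((-X 0) ^ j * X 1 ^ (k - j))

theorem commute_pderivEnd (i j : Fin 2) : Commute (pderivEnd i) (pderivEnd j) := by
  have h : ⁅(pderiv i : Derivation ℂ (MvPolynomial (Fin 2) ℂ) (MvPolynomial (Fin 2) ℂ)),
      pderiv (R := ℂ) j⁆ = 0 := by
    apply MvPolynomial.derivation_ext
    intro a
    rw [Derivation.commutator_apply]
    simp only [pderiv_X, Pi.single_apply]
    split_ifs <;> simp
  refine LinearMap.ext fun F => ?_
  have := DFunLike.congr_fun h F
  rw [Derivation.commutator_apply] at this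
  exact sub_eq_zero.mp this

theorem pderivEnd_pow_apply (i : Fin 2) (k : ℕ) (F : MvPolynomial (Fin 2) ℂ) :
    (pderivEnd i ^ k) F = (⇑(pderiv i))^[k] F :=
  Module.End.pow_apply _ _ _

theorem isHomogeneous_pderivEnd {i : Fin 2} {n : ℕ} {F : MvPolynomial (Fin 2) ℂ}
    (hF : F.IsHomogeneous n) : (pderivEnd i F).IsHomogeneous (n - 1) :=
  hF.pderiv

theorem isHomogeneous_pderivEnd_pow {i : Fin 2} {n k : ℕ} {F : MvPolynomial (Fin 2) ℂ}
    (hF : F.IsHomogeneous n) : ((pderivEnd i ^ k) F).IsHomogeneous (n - k) := by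
  induction k with
  | zero => simpa using hF
  | succ k ih =>
    rw [pow_succ', Module.End.mul_apply, ← Nat.sub_sub]
    exact isHomogeneous_pderivEnd ih

theorem smul_isHomogeneous {n : ℕ} {F : MvPolynomial (Fin 2) ℂ} (hF : F.IsHomogeneous n) (c : ℂ) :
    (c • F).IsHomogeneous n :=
  (homogeneousSubmodule (Fin 2) ℂ n).smul_mem c hF

theorem isHomogeneous_of_X_mul {i : Fin 2} {n : ℕ} {F : MvPolynomial (Fin 2) ℂ}
    (h : (X i * F).IsHomogeneous (n + 1)) : F.IsHomogeneous n := by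
  intro m hm
  have := @h (Finsupp.single i 1 + m) (by rwa [coeff_X_mul])
  simp only [Finsupp.weight_apply, Finsupp.sum_fintype, Fin.sum_univ_two, Finsupp.add_apply,
    Pi.one_apply, smul_eq_mul, mul_one, implies_true] at this ⊢
  fin_cases i <;> simp at this <;> omega

theorem directional_pow_apply (s : ℂ) (k : ℕ) (F : MvPolynomial (Fin 2) ℂ) :
    (directional s ^ k) F = ∑ j ∈ range (k + 1),
      s ^ j • (((-1) ^ (k - j) * (k.choose j : ℂ)) •
        (pderivEnd 0 ^ j) ((pderivEnd 1 ^ (k - j)) F)) := by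
  have hc : Commute (s • pderivEnd 0) ((-1 : ℂ) • pderivEnd 1) :=
    ((commute_pderivEnd 0 1).smul_right _).smul_left s
  have hd : directional s = s • pderivEnd 0 + (-1 : ℂ) • pderivEnd 1 := by
    exact LinearMap.ext fun F => by simp [directional, sub_eq_add_neg]
  rw [hd, hc.add_pow, LinearMap.sum_apply]
  refine sum_congr rfl fun j _ => ?_
  rw [smul_pow, smul_pow, ← nsmul_eq_mul', ← Nat.cast_smul_eq_nsmul ℂ]
  simp only [smul_mul_assoc, mul_smul_comm, LinearMap.smul_apply, Module.End.mul_apply, smul_smul]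
  congr 1
  ring

/-- Iterated Euler identity. -/
theorem sum_choose_mul_pderivEnd_pow (k N : ℕ) {F : MvPolynomial (Fin 2) ℂ}
    (hF : F.IsHomogeneous N) :
    ∑ j ∈ range (k + 1), (k.choose j : ℂ) •
      ((pderivEnd 0 ^ j) ((pderivEnd 1 ^ (k - j)) F) * (X 0 ^ j * X 1 ^ (k - j))) =
      (N.descFactorial k : ℂ) • F := by
  induction k generalizing N F with
  | zero => simp
  | succ k ih =>
    have h0 := ih (N - 1) (isHomogeneous_pderivEnd (i := 0) hF)
    have h1 := ih (N - 1) (isHomogeneous_pderivEnd (i := 1) hF)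
    have hE : X 0 * pderivEnd 0 F + X 1 * pderivEnd 1 F = (N : ℂ) • F := by
      have := hF.sum_X_mul_pderiv
      rw [Fin.sum_univ_two] at this
      rw [Nat.cast_smul_eq_nsmul]
      exact this
    have hd : ((N.descFactorial (k + 1) : ℕ) : ℂ) = ((N - 1).descFactorial k : ℂ) * N := by
      cases N with
      | zero => simp
      | succ N => rw [Nat.succ_descFactorial_succ]; push_cast; simp [mul_comm]
    rw [hd, mul_smul, ← hE, smul_add, ← mul_smul_comm, ← mul_smul_comm, ← h0, ← h1]
    rw [Finset.sum_range_succ', mul_sum, mul_sum]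
    have e0 : ∀ j ∈ range (k + 1), ((k + 1).choose (j + 1) : ℂ) •
        ((pderivEnd 0 ^ (j + 1)) ((pderivEnd 1 ^ (k + 1 - (j + 1))) F) *
          (X 0 ^ (j + 1) * X 1 ^ (k + 1 - (j + 1)))) =
        X 0 * ((k.choose j : ℂ) • ((pderivEnd 0 ^ j) ((pderivEnd 1 ^ (k - j)) (pderivEnd 0 F)) *
          (X 0 ^ j * X 1 ^ (k - j)))) + (k.choose (j + 1) : ℂ) •
        ((pderivEnd 0 ^ (j + 1)) ((pderivEnd 1 ^ (k - j)) F) *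
          (X 0 ^ (j + 1) * X 1 ^ (k - j))) := by
      intro j _
      rw [Nat.choose_succ_succ, Nat.cast_add, add_smul, Nat.add_sub_add_right,
        ← Module.End.mul_apply (pderivEnd 1 ^ (k - j)),
        ((commute_pderivEnd 1 0).pow_left (k - j)).eq, Module.End.mul_apply, pow_succ (pderivEnd 0),
        Module.End.mul_apply]
      congr 1
      rw [mul_smul_comm]
      congr 1
      ring
    rw [sum_congr rfl e0, sum_add_distrib, add_assoc]
    congr 1
    rw [sum_range_succ, Finset.sum_range_succ' _ k]
    simp only [Nat.choose_succ_self, Nat.cast_zero, zero_smul, add_zero]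
    have key : ∀ j ≤ k, X 1 * ((k.choose j : ℂ) • ((pderivEnd 0 ^ j)
        ((pderivEnd 1 ^ (k - j)) (pderivEnd 1 F)) * (X 0 ^ j * X 1 ^ (k - j)))) =
        (k.choose j : ℂ) • ((pderivEnd 0 ^ j) ((pderivEnd 1 ^ (k + 1 - j)) F) *
          (X 0 ^ j * X 1 ^ (k + 1 - j))) := by
      intro j hj
      rw [mul_smul_comm, Nat.sub_add_comm hj, pow_succ (pderivEnd 1), Module.End.mul_apply]
      congr 1
      ring
    congr 1
    · refine sum_congr rfl fun j hj => ?_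
      rw [key _ (by have := mem_range.1 hj; omega), Nat.add_sub_add_right]
    · rw [key 0 (Nat.zero_le _)]
      simp

/-- Division by `x₁ + s x₂`, on the level of coefficients with respect to `s`. -/
theorem exists_quotient_of_homEval_eq_zero (k m : ℕ) (P : ℕ → MvPolynomial (Fin 2) ℂ)
    (hP : ∀ j ≤ k + 1, (P j).IsHomogeneous (m + 1)) (h : homEval (k + 1) P = 0) :
    ∃ Q : ℕ → MvPolynomial (Fin 2) ℂ, (∀ j, (Q j).IsHomogeneous m) ∧ Q (k + 1) = 0 ∧
      P 0 = X 0 * Q 0 ∧ ∀ j ≤ k, P (j + 1) = X 0 * Q (j + 1) + X 1 * Q j := by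
  have hX : ∀ i : Fin 2, (X i : MvPolynomial (Fin 2) ℂ) ≠ 0 := fun i => X_ne_zero i
  induction k generalizing P with
  | zero =>
    have h' : P 0 * X 1 = X 0 * P 1 := by
      simp [homEval, sum_range_succ] at h
      linear_combination h
    obtain ⟨Q, hQ⟩ : X 0 ∣ P 0 := by
      have hd : (X 0 : MvPolynomial (Fin 2) ℂ) ∣ P 0 * X 1 := ⟨_, h'⟩
      refine ((X_prime (i := (0 : Fin 2)) (R := ℂ)).dvd_or_dvd hd).resolve_right fun hd => ?_
      simp [X_dvd_X] at hd
    refine ⟨fun j => if j = 0 then Q else 0, ?_, by simp, by simpa using hQ, ?_⟩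
    · intro j
      dsimp only
      split_ifs
      · exact isHomogeneous_of_X_mul (i := 0) (hQ ▸ hP 0 (by omega))
      · exact isHomogeneous_zero _ _ _
    · intro j hj
      obtain rfl : j = 0 := by omega
      apply mul_left_cancel₀ (hX 0)
      simp only [zero_add, one_ne_zero, if_false, if_true]
      linear_combination -h' + X 1 * hQ
  | succ k ih =>
    unfold homEval at h
    rw [sum_range_succ'] at h
    have h1 : ∑ j ∈ range (k + 1 + 1), P (j + 1) *
        ((-X 0) ^ (j + 1) * X 1 ^ (k + 1 + 1 - (j + 1))) = -X 0 * homEval (k + 1) fun j => P (j + 1) := by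
      rw [homEval, mul_sum]
      refine sum_congr rfl fun j _ => ?_
      rw [Nat.add_sub_add_right]
      ring
    rw [h1] at h
    obtain ⟨Q, hQ⟩ : X 0 ∣ P 0 := by
      have hd : (X 0 : MvPolynomial (Fin 2) ℂ) ∣ P 0 * X 1 ^ (k + 1 + 1) :=
        ⟨homEval (k + 1) fun j => P (j + 1), by simp at h; linear_combination h⟩
      refine ((X_prime (i := (0 : Fin 2)) (R := ℂ)).dvd_or_dvd hd).resolve_right fun hd => ?_
      have := (X_prime (i := (0 : Fin 2)) (R := ℂ)).dvd_of_dvd_pow hd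
      simp [X_dvd_X] at this
    have hQh : Q.IsHomogeneous m := isHomogeneous_of_X_mul (i := 0) (hQ ▸ hP 0 (by omega))
    obtain ⟨Q', hQ'h, hQ'k, hQ'0, hQ'⟩ := ih (fun j => P (j + 1) - if j = 0 then X 1 * Q else 0)
      (by
        intro j hj
        refine (hP (j + 1) (by omega)).sub ?_
        split_ifs
        · rw [add_comm]; exact (isHomogeneous_X _ _).mul hQh
        · exact isHomogeneous_zero _ _ _)
      (by
        apply mul_left_cancel₀ (hX 0)
        have : homEval (k + 1) (fun j => P (j + 1) - if j = 0 then X 1 * Q else 0) =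
            homEval (k + 1) (fun j => P (j + 1)) - X 1 * Q * X 1 ^ (k + 1) := by
          simp only [homEval, sub_mul, sum_sub_distrib]
          congr 1
          rw [sum_range_succ']
          simp
        rw [this]
        simp at h
        linear_combination -h + X 1 ^ (k + 1 + 1) * hQ)
    refine ⟨fun j => if j = 0 then Q else Q' (j - 1), ?_, by simpa using hQ'k, by simpa using hQ,
      ?_⟩
    · intro j
      dsimp only
      split_ifs
      exacts [hQh, hQ'h _]
    · intro j hj
      rcases j with _ | j
      · simp at hQ'0 ⊢
        linear_combination hQ'0
      · have := hQ' j (by omega)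
        simpa using this

theorem homEval_sub (k : ℕ) (P Q : ℕ → MvPolynomial (Fin 2) ℂ) :
    homEval k (fun j => P j - Q j) = homEval k P - homEval k Q := by
  simp only [homEval, sub_mul, sum_sub_distrib]

theorem isHomogeneous_homEval {k m : ℕ} {P : ℕ → MvPolynomial (Fin 2) ℂ}
    (hP : ∀ j ≤ k, (P j).IsHomogeneous m) : (homEval k P).IsHomogeneous (m + k) := by
  refine IsHomogeneous.sum _ _ _ fun j hj => ?_
  have hj : j ≤ k := by have := mem_range.1 hj; omega
  have h := (hP j hj).mul
    (((isHomogeneous_X ℂ (0 : Fin 2)).neg.pow j).mul ((isHomogeneous_X ℂ (1 : Fin 2)).pow (k - j)))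
  rwa [one_mul, one_mul, Nat.add_sub_cancel' hj] at h

/-- The coefficients of `directional s ^ k` applied to `F`, as a polynomial in `s`. -/
noncomputable def directionalCoeff (k : ℕ) (F : MvPolynomial (Fin 2) ℂ) (j : ℕ) :
    MvPolynomial (Fin 2) ℂ :=
  ((-1) ^ (k - j) * (k.choose j : ℂ)) • (pderivEnd 0 ^ j) ((pderivEnd 1 ^ (k - j)) F)

theorem isHomogeneous_directionalCoeff {k m j : ℕ} {F : MvPolynomial (Fin 2) ℂ} (hj : j ≤ k)
    (hF : F.IsHomogeneous (m + k)) : (directionalCoeff k F j).IsHomogeneous m := by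
  have := isHomogeneous_pderivEnd_pow (i := 0) (k := j)
    (isHomogeneous_pderivEnd_pow (i := 1) (k := k - j) hF)
  rw [show m + k - (k - j) - j = m by omega] at this
  exact smul_isHomogeneous this _

theorem homEval_directionalCoeff (k N : ℕ) {F : MvPolynomial (Fin 2) ℂ} (hF : F.IsHomogeneous N) :
    homEval k (directionalCoeff k F) = ((-1) ^ k * (N.descFactorial k : ℂ)) • F := by
  rw [mul_smul, ← sum_choose_mul_pderivEnd_pow k N hF, smul_sum]
  refine sum_congr rfl fun j hj => ?_
  have hj : j ≤ k := by have := mem_range.1 hj; omega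
  rw [directionalCoeff, smul_mul_assoc, smul_smul]
  have hk : (-1 : ℂ) ^ k = (-1) ^ (k - j) * (-1) ^ j := by rw [← pow_add, Nat.sub_add_cancel hj]
  rcases Nat.even_or_odd j with h | h <;> simp [hk, h.neg_pow]

/-- The homogenized derivative with respect to `y` of `∑ j, P j * y ^ j`, evaluated at
`(-x₁, x₂)`. -/
noncomputable def homEvalDeriv (k : ℕ) (P : ℕ → MvPolynomial (Fin 2) ℂ) :
    MvPolynomial (Fin 2) ℂ :=
  homEval k fun j => ((j + 1 : ℕ) : ℂ) • P (j + 1)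

theorem homEvalDeriv_sub (k : ℕ) (P Q : ℕ → MvPolynomial (Fin 2) ℂ) :
    homEvalDeriv k (fun j => P j - Q j) = homEvalDeriv k P - homEvalDeriv k Q := by
  simp only [homEvalDeriv, smul_sub, homEval_sub]

theorem homEvalDeriv_directionalCoeff (k N : ℕ) {F : MvPolynomial (Fin 2) ℂ}
    (hF : F.IsHomogeneous N) :
    homEvalDeriv k (directionalCoeff (k + 1) F) =
      ((-1) ^ k * ((k + 1) * ((N - 1).descFactorial k : ℂ))) • pderivEnd 0 F := by
  have : homEvalDeriv k (directionalCoeff (k + 1) F) =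
      ((k + 1 : ℕ) : ℂ) • homEval k (directionalCoeff k (pderivEnd 0 F)) := by
    rw [homEvalDeriv, homEval, homEval, smul_sum]
    refine sum_congr rfl fun j _ => ?_
    simp only [directionalCoeff, smul_mul_assoc, smul_smul]
    rw [Nat.add_sub_add_right, ← Module.End.mul_apply (pderivEnd 1 ^ (k - j)),
        ((commute_pderivEnd 1 0).pow_left (k - j)).eq, Module.End.mul_apply, pow_succ (pderivEnd 0),
        Module.End.mul_apply]
    congr 1
    have h := congrArg (Nat.cast (R := ℂ)) (Nat.add_one_mul_choose_eq k j)
    push_cast at h ⊢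
    linear_combination -(-1) ^ (k - j) * h
  rw [this, homEval_directionalCoeff k (N - 1) (isHomogeneous_pderivEnd hF), smul_smul]
  congr 1
  push_cast
  ring

theorem exists_reduction (k m : ℕ) (P : ℕ → MvPolynomial (Fin 2) ℂ)
    (hP : ∀ j ≤ k + 1, (P j).IsHomogeneous (m + 1)) :
    ∃ (c : ℂ) (Q : ℕ → MvPolynomial (Fin 2) ℂ), (∀ j, (Q j).IsHomogeneous m) ∧
      (∀ s : ℂ, ∑ j ∈ range (k + 1 + 1), s ^ j • P j =
        (directional s ^ (k + 1)) (c • homEval (k + 1) P) +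
          linearForm s * ∑ j ∈ range (k + 1), s ^ j • Q j) ∧
      X 1 * homEval k Q = homEvalDeriv k P +
        ((k + 1 : ℂ) / (m + k + 2)) • pderivEnd 0 (homEval (k + 1) P) := by
  have hR := isHomogeneous_homEval hP
  set R := homEval (k + 1) P
  set N := m + 1 + (k + 1) with hN
  have hNk : (N.descFactorial (k + 1) : ℂ) ≠ 0 := by
    rw [Nat.cast_ne_zero, Ne, Nat.descFactorial_eq_zero_iff_lt]
    omega
  have hNs : N.descFactorial (k + 1) = N * (N - 1).descFactorial k := by
    rw [show N = (m + k + 1) + 1 by omega, Nat.succ_descFactorial_succ]; simp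
  set c : ℂ := (-1) ^ (k + 1) / N.descFactorial (k + 1) with hc
  have hsq : ((-1 : ℂ) ^ (k + 1)) * (-1) ^ (k + 1) = 1 := by
    rw [← mul_pow]; simp
  have hcR : (c • R).IsHomogeneous N := smul_isHomogeneous hR c
  obtain ⟨Q, hQ, hQk, hQ0, hQs⟩ := exists_quotient_of_homEval_eq_zero k m
    (fun j => P j - directionalCoeff (k + 1) (c • R) j)
    (fun j hj => (hP j hj).sub (isHomogeneous_directionalCoeff hj hcR))
    (by
      rw [homEval_sub, homEval_directionalCoeff _ _ hcR, smul_smul, hc,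
        show (-1 : ℂ) ^ (k + 1) * (N.descFactorial (k + 1)) *
          ((-1) ^ (k + 1) / N.descFactorial (k + 1)) = 1 by
            field_simp; linear_combination hsq, one_smul, sub_self])
  refine ⟨c, Q, hQ, fun s => ?_, ?_⟩
  · have hd : (directional s ^ (k + 1)) (c • R) =
        ∑ j ∈ range (k + 1 + 1), s ^ j • directionalCoeff (k + 1) (c • R) j :=
      directional_pow_apply s (k + 1) (c • R)
    rw [hd, ← sub_eq_iff_eq_add', ← sum_sub_distrib]
    simp only [← smul_sub]
    rw [sum_range_succ', hQ0, linearForm, add_mul, mul_sum, mul_sum]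
    have : ∀ j ∈ range (k + 1), s ^ (j + 1) • (P (j + 1) - directionalCoeff (k + 1) (c • R) (j + 1))
        = X 0 * s ^ (j + 1) • Q (j + 1) + s • X 1 * s ^ j • Q j := by
      intro j hj
      rw [hQs j (by have := mem_range.1 hj; omega)]
      simp only [smul_eq_C_mul, map_pow]
      ring
    rw [sum_congr rfl this, sum_add_distrib]
    have h2 := sum_range_succ' (fun j => X 0 * s ^ j • Q j) (k + 1)
    rw [sum_range_succ, hQk] at h2
    simp only [smul_zero, mul_zero, add_zero] at h2
    rw [h2]
    simp
    ring
  · have h1 : homEvalDeriv k P = homEvalDeriv k (directionalCoeff (k + 1) (c • R)) +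
        X 1 * homEval k Q := by
      rw [← sub_eq_iff_eq_add', ← homEvalDeriv_sub, homEvalDeriv, homEval, homEval, mul_sum]
      have hs : ∀ j ∈ range (k + 1), (((j + 1 : ℕ) : ℂ) •
          (P (j + 1) - directionalCoeff (k + 1) (c • R) (j + 1))) *
            ((-X 0) ^ j * X 1 ^ (k - j)) =
          X 1 * (Q j * ((-X 0) ^ j * X 1 ^ (k - j))) +
          ((j : ℂ) • (Q j * ((-X 0) ^ j * X 1 ^ (k + 1 - j))) -
          ((j + 1 : ℕ) : ℂ) • (Q (j + 1) * ((-X 0) ^ (j + 1) * X 1 ^ (k + 1 - (j + 1))))) := by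
        intro j hj
        have hj : j ≤ k := by have := mem_range.1 hj; omega
        rw [hQs j hj, Nat.add_sub_add_right, Nat.sub_add_comm hj]
        simp only [smul_eq_C_mul, Nat.cast_add, Nat.cast_one, map_add, map_one]
        ring
      rw [sum_congr rfl hs, sum_add_distrib,
        sum_range_sub' fun j => (j : ℂ) • (Q j * ((-X 0) ^ j * X 1 ^ (k + 1 - j))), hQk]
      simp
    rw [h1, homEvalDeriv_directionalCoeff _ _ hcR, map_smul, smul_smul]
    rw [add_assoc, add_comm (X 1 * _), ← add_assoc, ← add_smul]
    rw [show (-1) ^ k * ((k + 1) * ((N - 1).descFactorial k : ℂ)) * c +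
      (k + 1 : ℂ) / (m + k + 2) = 0 from ?_, zero_smul, zero_add]
    have hN' : (N : ℂ) = m + k + 2 := by rw [hN]; push_cast; ring
    have hN0 : (m + k + 2 : ℂ) ≠ 0 := by
      rw [← hN', Nat.cast_ne_zero]; omega
    have hD : ((N - 1).descFactorial k : ℂ) ≠ 0 := by
      rw [hNs] at hNk
      push_cast at hNk
      exact right_ne_zero_of_mul hNk
    rw [hc, hNs]
    push_cast
    rw [hN']
    field_simp
    have hsq' : ((-1 : ℂ) ^ k) * (-1) ^ k = 1 := by
      rw [← mul_pow]; simp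
    rw [pow_succ]
    linear_combination -(k + 1 : ℂ) * hsq'

/-- Clebsch-Gordan decomposition of a polynomial in `s` with forms as coefficients. -/
theorem exists_decomposition (k m : ℕ) (hkm : k ≤ m) (P : ℕ → MvPolynomial (Fin 2) ℂ)
    (hP : ∀ j ≤ k, (P j).IsHomogeneous m) :
    ∃ C : ℕ → MvPolynomial (Fin 2) ℂ, (∀ q ≤ k, (C q).IsHomogeneous (m + k - 2 * q)) ∧
      ∀ s : ℂ, ∑ j ∈ range (k + 1), s ^ j • P j =
        ∑ q ∈ range (k + 1), linearForm s ^ q * (directional s ^ (k - q)) (C q) := by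
  induction k generalizing m P with
  | zero => exact ⟨P, by simpa using hP, by simp⟩
  | succ k ih =>
    obtain ⟨m, rfl⟩ : ∃ n, m = n + 1 := ⟨m - 1, by omega⟩
    obtain ⟨c, Q, hQ, hs, -⟩ := exists_reduction k m P hP
    obtain ⟨C, hC, hCs⟩ := ih m (by omega) Q fun j _ => hQ j
    refine ⟨fun q => if q = 0 then c • homEval (k + 1) P else C (q - 1), ?_, fun s => ?_⟩
    · rintro (_ | q) hq
      · exact smul_isHomogeneous (isHomogeneous_homEval hP) c
      · have := hC q (by omega)
        rw [show m + k - 2 * q = m + 1 + (k + 1) - 2 * (q + 1) by omega] at this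
        simpa using this
    · rw [hs, hCs, sum_range_succ' _ (k + 1), mul_sum, add_comm]
      simp [pow_succ', mul_assoc]

theorem exists_decomposition_of_homEvalDeriv (k m : ℕ) (hkm : k ≤ m)
    (P : ℕ → MvPolynomial (Fin 2) ℂ) (hP : ∀ j ≤ k + 2, (P j).IsHomogeneous (m + 2))
    (hN : homEvalDeriv (k + 1) P +
      ((k + 2 : ℂ) / (m + k + 4)) • pderivEnd 0 (homEval (k + 2) P) = 0) :
    ∃ C : ℕ → MvPolynomial (Fin 2) ℂ,
      (∀ q ≤ k + 2, (C q).IsHomogeneous (m + 2 + (k + 2) - 2 * q)) ∧ C 1 = 0 ∧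
      ∀ s : ℂ, ∑ j ∈ range (k + 2 + 1), s ^ j • P j =
        ∑ q ∈ range (k + 2 + 1), linearForm s ^ q * (directional s ^ (k + 2 - q)) (C q) := by
  obtain ⟨c, Q, hQ, hs, hQN⟩ := exists_reduction (k + 1) (m + 1) P hP
  have hQ0 : homEval (k + 1) Q = 0 := by
    rw [show ((((k + 1 : ℕ) : ℂ) + 1) / (((m + 1 : ℕ) : ℂ) + ((k + 1 : ℕ) : ℂ) + 2)) =
      ((k + 2 : ℂ) / (m + k + 4)) by push_cast; ring, hN] at hQN
    exact (mul_eq_zero.mp hQN).resolve_left (X_ne_zero _)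
  obtain ⟨c', Q', hQ', hs', -⟩ := exists_reduction k m Q fun j _ => hQ j
  obtain ⟨C, hC, hCs⟩ := exists_decomposition k m hkm Q' fun j _ => hQ' j
  refine ⟨fun q => if q = 0 then c • homEval (k + 2) P else if q = 1 then 0 else C (q - 2), ?_,
    by simp, fun s => ?_⟩
  · rintro (_ | _ | q) hq
    · exact smul_isHomogeneous (isHomogeneous_homEval hP) c
    · exact isHomogeneous_zero _ _ _
    · have := hC q (by omega)
      rw [show m + k - 2 * q = m + 2 + (k + 2) - 2 * (q + 1 + 1) by omega] at this
      simpa using this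
  · rw [hs, hs', hCs, hQ0, sum_range_succ' _ (k + 2), sum_range_succ' _ (k + 1), smul_zero,
      map_zero, zero_add, mul_sum, mul_sum, add_comm]
    simp [pow_succ', mul_assoc]

theorem pderivEnd_linearForm_pow (i : Fin 2) (s : ℂ) (n : ℕ) :
    pderivEnd i (linearForm s ^ n) = ((n : ℂ) * s ^ (i : ℕ)) • linearForm s ^ (n - 1) := by
  have : pderiv i (linearForm s ^ n) =
      (n : MvPolynomial (Fin 2) ℂ) * linearForm s ^ (n - 1) * pderiv i (linearForm s) := pderiv_pow
  change pderiv i (linearForm s ^ n) = _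
  rw [this]
  fin_cases i
  · simp [linearForm, pderiv_X, smul_eq_C_mul]
  · simp [linearForm, pderiv_X, smul_eq_C_mul]
    ring

theorem pderivEnd_pow_linearForm_pow (i : Fin 2) (s : ℂ) (n k : ℕ) :
    (pderivEnd i ^ k) (linearForm s ^ n) =
      ((n.descFactorial k : ℂ) * s ^ ((i : ℕ) * k)) • linearForm s ^ (n - k) := by
  induction k with
  | zero => simp
  | succ k ih =>
    rw [pow_succ', Module.End.mul_apply, ih, map_smul, pderivEnd_linearForm_pow, smul_smul,
      Nat.descFactorial_succ, Nat.sub_sub]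
    congr 1
    push_cast
    ring

theorem pderivEnd_pow_pderivEnd_pow_linearForm_pow (s : ℂ) (n a b : ℕ) :
    (pderivEnd 0 ^ a) ((pderivEnd 1 ^ b) (linearForm s ^ n)) =
      ((n.descFactorial (a + b) : ℂ) * s ^ b) • linearForm s ^ (n - (a + b)) := by
  rw [pderivEnd_pow_linearForm_pow, map_smul, pderivEnd_pow_linearForm_pow, smul_smul, add_comm a b,
    ← Nat.sub_sub]
  congr 1
  have : (n.descFactorial b * (n - b).descFactorial a) = n.descFactorial (b + a) := by
    rw [mul_comm, ← Nat.descFactorial_mul_descFactorial (Nat.le_add_right b a),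
      Nat.add_sub_cancel_left]
  rw [← this]
  push_cast
  simp
  ring

theorem transvectant_linearForm_pow (e d k : ℕ) (hk : k ≤ d) (E : MvPolynomial (Fin 2) ℂ) (s : ℂ) :
    transvectant e d k E (linearForm s ^ d) = (((e - k).factorial : ℂ) / e.factorial) •
      (linearForm s ^ (d - k) * (directional s ^ k) E) := by
  have h : ∀ i ∈ range (k + 1), ((-1 : ℂ) ^ i * (k.choose i : ℂ)) •
        ((⇑(pderiv (0 : Fin 2)))^[k - i] ((⇑(pderiv (1 : Fin 2)))^[i] E) *
          (⇑(pderiv (0 : Fin 2)))^[i] ((⇑(pderiv (1 : Fin 2)))^[k - i] (linearForm s ^ d))) =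
      (d.descFactorial k : ℂ) • (linearForm s ^ (d - k) * (s ^ (k - i) •
        (((-1) ^ (k - (k - i)) * (k.choose (k - i) : ℂ)) •
          (pderivEnd 0 ^ (k - i)) ((pderivEnd 1 ^ (k - (k - i))) E)))) := by
    intro i hi
    have hi : i ≤ k := by have := mem_range.1 hi; omega
    simp only [← pderivEnd_pow_apply]
    rw [pderivEnd_pow_pderivEnd_pow_linearForm_pow, Nat.choose_symm hi, Nat.sub_sub_self hi,
      Nat.add_sub_cancel' hi]
    simp only [smul_eq_C_mul, map_mul]
    ring
  rw [transvectant, sum_congr rfl h, ← smul_sum, ← mul_sum, sum_flip fun j => s ^ j •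
        (((-1) ^ (k - j) * (k.choose j : ℂ)) •
          (pderivEnd 0 ^ j) ((pderivEnd 1 ^ (k - j)) E)), ← directional_pow_apply, smul_smul]
  congr 1
  have hd := congrArg (Nat.cast (R := ℂ)) (Nat.factorial_mul_descFactorial hk)
  push_cast at hd ⊢
  rw [← hd]
  have h1 : ((d - k).factorial : ℂ) ≠ 0 := by exact_mod_cast (d - k).factorial_ne_zero
  have h2 : (d.descFactorial k : ℂ) ≠ 0 := by
    rw [Nat.cast_ne_zero, Ne, Nat.descFactorial_eq_zero_iff_lt]
    omega
  field_simp

theorem transvectant_add_left (e f k : ℕ) (E E' F : MvPolynomial (Fin 2) ℂ) :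
    transvectant e f k (E + E') F = transvectant e f k E F + transvectant e f k E' F := by
  simp only [transvectant, ← pderivEnd_pow_apply, map_add, add_mul, smul_add, sum_add_distrib]

theorem transvectant_add_right (e f k : ℕ) (E F F' : MvPolynomial (Fin 2) ℂ) :
    transvectant e f k E (F + F') = transvectant e f k E F + transvectant e f k E F' := by
  simp only [transvectant, ← pderivEnd_pow_apply, map_add, mul_add, smul_add, sum_add_distrib]

theorem transvectant_smul_left (e f k : ℕ) (c : ℂ) (E F : MvPolynomial (Fin 2) ℂ) :
    transvectant e f k (c • E) F = c • transvectant e f k E F := by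
  simp only [transvectant, ← pderivEnd_pow_apply, map_smul, smul_mul_assoc, smul_comm _ c,
    ← smul_sum]

theorem transvectant_smul_right (e f k : ℕ) (c : ℂ) (E F : MvPolynomial (Fin 2) ℂ) :
    transvectant e f k E (c • F) = c • transvectant e f k E F := by
  simp only [transvectant, ← pderivEnd_pow_apply, map_smul, mul_smul_comm, smul_comm _ c,
    ← smul_sum]

theorem transvectant_zero_left (e f k : ℕ) (F : MvPolynomial (Fin 2) ℂ) :
    transvectant e f k 0 F = 0 := by
  simpa using transvectant_smul_left e f k 0 0 F

theorem transvectant_zero_right (e f k : ℕ) (E : MvPolynomial (Fin 2) ℂ) :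
    transvectant e f k E 0 = 0 := by
  simpa using transvectant_smul_right e f k 0 E 0

/-- The Wronskian as a multilinear map. -/
noncomputable def wronskianMultilinear (n s : ℕ) :
    MultilinearMap ℂ (fun _ : Fin s => MvPolynomial (Fin 2) ℂ) (MvPolynomial (Fin 2) ℂ) :=
  (((n - s + 1).factorial : ℂ) / (n.factorial : ℂ)) ^ s •
    ((Matrix.detRowAlternating (R := MvPolynomial (Fin 2) ℂ)
      (n := Fin s)).toMultilinearMap.restrictScalars ℂ).compLinearMap fun _ =>
        LinearMap.pi fun j : Fin s => pderivEnd 0 ^ (s - 1 - (j : ℕ)) * pderivEnd 1 ^ (j : ℕ)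

theorem wronskianMultilinear_apply (n : ℕ) {s : ℕ} (F : Fin s → MvPolynomial (Fin 2) ℂ) :
    wronskianMultilinear n s F = wronskian n F := by
  simp only [wronskian, ← pderivEnd_pow_apply]
  rfl

theorem det_vandermonde_snoc {r : ℕ} (t : Fin r → ℂ) (s : ℂ) :
    (Matrix.vandermonde (Fin.snoc t s : Fin (r + 1) → ℂ)).det =
      (Matrix.vandermonde t).det * ∏ i, (s - t i) := by
  rw [Matrix.det_vandermonde, Matrix.det_vandermonde, Fin.prod_univ_castSucc, ← prod_mul_distrib]
  have : Ioi (Fin.last r) = ∅ := by ext x; simp [Fin.le_last]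
  rw [this, prod_empty, mul_one]
  refine prod_congr rfl fun i _ => ?_
  have : Ioi (Fin.castSucc i) = insert (Fin.last r) ((Ioi i).map Fin.castSuccEmb) := by
    ext x
    refine Fin.lastCases ?_ (fun j => ?_) x
    · simp [Fin.castSucc_lt_last]
    · simp [Fin.le_last]
  rw [this, prod_insert (by simp), prod_map, mul_comm]
  simp

theorem exists_wronskian_linearForm_pow (d r : ℕ) :
    ∃ c : ℂ, ∀ τ : Fin (r + 1) → ℂ, wronskian d (fun i => linearForm (τ i) ^ d) =
      (c * (Matrix.vandermonde τ).det) • ∏ i, linearForm (τ i) ^ (d - r) := by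
  refine ⟨(((d - (r + 1) + 1).factorial : ℂ) / (d.factorial : ℂ)) ^ (r + 1) *
    (d.descFactorial r) ^ (r + 1), fun τ => ?_⟩
  have : (Matrix.of fun i j : Fin (r + 1) =>
      (⇑(pderiv (0 : Fin 2)))^[r + 1 - 1 - (j : ℕ)]
        ((⇑(pderiv (1 : Fin 2)))^[(j : ℕ)] (linearForm (τ i) ^ d))) =
      Matrix.of fun i j => ((d.descFactorial r : ℂ) • linearForm (τ i) ^ (d - r)) *
        ((C : ℂ →+* MvPolynomial (Fin 2) ℂ).mapMatrix (Matrix.vandermonde τ)) i j := by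
    ext1 i j
    have hj : r + 1 - 1 - (j : ℕ) + j = r := by omega
    simp only [Matrix.of_apply, ← pderivEnd_pow_apply]
    rw [pderivEnd_pow_pderivEnd_pow_linearForm_pow, hj]
    simp only [RingHom.mapMatrix_apply, Matrix.map_apply, Matrix.vandermonde_apply, smul_eq_C_mul,
      map_mul]
    ring
  rw [wronskian, this, Matrix.det_mul_column, ← RingHom.map_det, prod_smul, prod_const]
  simp only [smul_eq_C_mul, map_mul, card_univ, Fintype.card_fin]
  ring

theorem exists_coeff_prod_sub {r : ℕ} (t : Fin r → ℂ) :
    ∃ p : ℕ → ℂ, p (r + 1) = 0 ∧ ∀ u v : MvPolynomial (Fin 2) ℂ,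
      ∑ j ∈ range (r + 1), p j • (u ^ j * v ^ (r - j)) = ∏ i, (u - t i • v) := by
  induction r with
  | zero => exact ⟨fun j => if j = 0 then 1 else 0, by simp, by simp⟩
  | succ r ih =>
    obtain ⟨p, hp0, hp⟩ := ih fun i => t i.castSucc
    refine ⟨fun j => (if j = 0 then 0 else p (j - 1)) - t (Fin.last r) *
      (if j = r + 2 then 0 else p j), by simp [hp0], fun u v => ?_⟩
    rw [Fin.prod_univ_castSucc, ← hp, mul_sub]
    simp only [sub_smul, sum_sub_distrib]
    congr 1
    · rw [sum_range_succ', sum_mul]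
      simp only [Nat.add_sub_add_right]
      simp [pow_succ, mul_comm, mul_assoc]
    · rw [sum_range_succ, sum_mul]
      simp [hp0]
      refine sum_congr rfl fun j hj => ?_
      have hj : j ≤ r := by have := mem_range.1 hj; omega
      rw [if_neg (by omega), Nat.sub_add_comm hj, pow_succ]
      simp only [smul_eq_C_mul, map_mul]
      ring

theorem isHomogeneous_linearForm (s : ℂ) : (linearForm s).IsHomogeneous 1 :=
  (isHomogeneous_X _ _).add (smul_isHomogeneous (isHomogeneous_X _ _) s)

theorem pderivEnd_zero_homEval_C (k : ℕ) (p : ℕ → ℂ) :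
    pderivEnd 0 (homEval (k + 1) fun j => C (p j)) = -homEvalDeriv k fun j => C (p j) := by
  have h : ∀ j ∈ range (k + 1 + 1), pderivEnd 0 (C (p j) * ((-X 0) ^ j * X 1 ^ (k + 1 - j))) =
      -((j : ℂ) • C (p j) * ((-X 0) ^ (j - 1) * X 1 ^ (k + 1 - j))) := by
    intro j _
    have h1 : pderiv 0 ((-X 0 : MvPolynomial (Fin 2) ℂ) ^ j) =
        (j : MvPolynomial (Fin 2) ℂ) * (-X 0) ^ (j - 1) * pderiv 0 (-X 0) := pderiv_pow
    have h2 : pderiv 0 ((X 1 : MvPolynomial (Fin 2) ℂ) ^ (k + 1 - j)) =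
        ((k + 1 - j : ℕ) : MvPolynomial (Fin 2) ℂ) * X 1 ^ (k + 1 - j - 1) * pderiv 0 (X 1) :=
      pderiv_pow
    change pderiv 0 (C (p j) * ((-X 0) ^ j * X 1 ^ (k + 1 - j))) = _
    rw [pderiv_C_mul, pderiv_mul, h1, h2, map_neg, pderiv_X_self,
      pderiv_X_of_ne (by decide : (1 : Fin 2) ≠ 0)]
    simp only [smul_eq_C_mul, map_natCast]
    ring
  rw [homEval, map_sum, sum_congr rfl h, sum_range_succ', homEvalDeriv, homEval, sum_neg_distrib]
  simp

theorem exists_decomposition_prod (k n : ℕ) (hn : 1 ≤ n) (t : Fin (k + 2) → ℂ) :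
    ∃ D : ℕ → MvPolynomial (Fin 2) ℂ,
      (∀ q ≤ k + 2, (D q).IsHomogeneous ((k + 2) * (n + 1) - 2 * q)) ∧ D 1 = 0 ∧
      ∀ s : ℂ, (∏ i, (s - t i)) • ∏ i, linearForm (t i) ^ n =
        ∑ q ∈ range (k + 2 + 1), linearForm s ^ q * (directional s ^ (k + 2 - q)) (D q) := by
  obtain ⟨p, -, hp⟩ := exists_coeff_prod_sub t
  set L := ∏ i, linearForm (t i) ^ n with hL
  have hmn : k + 2 ≤ (k + 2) * n := Nat.le_mul_of_pos_right _ hn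
  obtain ⟨m, hm⟩ : ∃ m, (k + 2) * n = m + 2 := ⟨(k + 2) * n - 2, by omega⟩
  have hLh : L.IsHomogeneous (m + 2) := by
    have := IsHomogeneous.prod univ (fun i => linearForm (t i) ^ n) (fun _ => n)
      fun i _ => by simpa using (isHomogeneous_linearForm (t i)).pow n
    simpa [hm] using this
  have hev : ∀ j : ℕ, homEval j (fun i => p i • L) = L * homEval j fun i => C (p i) := by
    intro j
    simp only [homEval, mul_sum, smul_eq_C_mul]
    exact sum_congr rfl fun i _ => by ring
  have hdev : homEvalDeriv (k + 1) (fun i => p i • L) =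
      L * homEvalDeriv (k + 1) fun i => C (p i) := by
    simp only [homEvalDeriv, homEval, mul_sum, smul_eq_C_mul]
    exact sum_congr rfl fun i _ => by ring
  set H : MvPolynomial (Fin 2) ℂ := homEval (k + 2) fun i => C (p i) with hH
  have hHprod : H = (-1) ^ (k + 2) * ∏ i, linearForm (t i) := by
    have h1 : H = ∏ i, (-X 0 - t i • X 1) := by
      rw [← hp, hH, homEval]
      simp only [smul_eq_C_mul]
    have h2 : ∀ i, (-X 0 - t i • X 1 : MvPolynomial (Fin 2) ℂ) = -1 * linearForm (t i) := by
      intro i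
      rw [linearForm]
      ring
    rw [h1, prod_congr rfl fun i _ => h2 i, prod_mul_distrib]
    simp
  have hsign : ((-1 : MvPolynomial (Fin 2) ℂ) ^ (k + 2)) * (-1) ^ (k + 2) = 1 := by
    rw [← mul_pow]; simp
  set ε : ℂ := ((-1) ^ (k + 2)) ^ n with hε
  have hLH : L = ε • H ^ n := by
    rw [hHprod, mul_pow, ← prod_pow, smul_eq_C_mul, hε, map_pow, map_pow, map_neg, map_one,
      ← mul_assoc, ← mul_pow, hsign, one_pow, one_mul]
  have hder : pderivEnd 0 (L * H) = -((n + 1 : ℂ) • (L * homEvalDeriv (k + 1) fun i => C (p i))) := by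
    have h1 : pderiv 0 (H ^ (n + 1)) = ((n + 1 : ℕ) : MvPolynomial (Fin 2) ℂ) * H ^ (n + 1 - 1) *
      pderiv 0 H := pderiv_pow
    have h2 : pderiv 0 H = -homEvalDeriv (k + 1) fun i => C (p i) :=
      pderivEnd_zero_homEval_C (k + 1) p
    rw [hLH, smul_mul_assoc, ← pow_succ, map_smul]
    change ε • pderiv 0 (H ^ (n + 1)) = _
    rw [h1, h2]
    simp only [smul_eq_C_mul, map_add, map_natCast, map_one, Nat.add_sub_cancel]
    push_cast
    ring
  obtain ⟨D, hD, hD1, hDs⟩ := exists_decomposition_of_homEvalDeriv k m (by omega)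
    (fun i => p i • L) (fun j _ => smul_isHomogeneous hLh _) (by
      rw [hev, hdev, hder]
      have hmc : ((k : ℂ) + 2) * n = m + 2 := by exact_mod_cast hm
      have hn0 : (n + 1 : ℂ) ≠ 0 := by exact_mod_cast n.succ_ne_zero
      have hk0 : (k + 2 : ℂ) ≠ 0 := by exact_mod_cast (k + 1).succ_ne_zero
      have : (k + 2 : ℂ) / (m + k + 4) * (n + 1) = 1 := by
        rw [show (m + k + 4 : ℂ) = (k + 2) * (n + 1) by linear_combination -hmc]
        field_simp
      rw [smul_neg, smul_smul, this, one_smul, add_neg_cancel])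
  refine ⟨D, fun q hq => ?_, hD1, fun s => ?_⟩
  · have := hD q hq
    rwa [show m + 2 + (k + 2) - 2 * q = (k + 2) * (n + 1) - 2 * q by rw [mul_add, hm]; simp] at this
  · rw [← hDs]
    have h1 := hp (C s) 1
    have h2 : ∏ i, (C s - t i • (1 : MvPolynomial (Fin 2) ℂ)) = C (∏ i, (s - t i)) := by
      rw [map_prod]
      exact prod_congr rfl fun i _ => by simp [smul_eq_C_mul]
    rw [h2] at h1
    rw [smul_eq_C_mul, ← h1, sum_mul]
    refine sum_congr rfl fun j _ => ?_
    simp only [smul_eq_C_mul, one_pow, map_pow]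
    ring

/-- Binary forms of order `d` are spanned by `d`-th powers of linear forms. -/
theorem mem_span_linearForm_pow {d : ℕ} {F : MvPolynomial (Fin 2) ℂ} (hF : F.IsHomogeneous d) :
    F ∈ Submodule.span ℂ (Set.range fun s : ℂ => linearForm s ^ d) := by
  have hmon : ∀ j ≤ d, (X 0 : MvPolynomial (Fin 2) ℂ) ^ (d - j) * X 1 ^ j ∈
      Submodule.span ℂ (Set.range fun s : ℂ => linearForm s ^ d) := by
    intro j hj
    set V := Matrix.vandermonde fun i : Fin (d + 1) => ((i : ℕ) : ℂ) with hV
    have hVu : IsUnit V.det := by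
      rw [isUnit_iff_ne_zero, hV, Matrix.det_vandermonde_ne_zero_iff]
      intro a b hab
      have hab' : ((a : ℕ) : ℂ) = ((b : ℕ) : ℂ) := hab
      exact Fin.ext (by exact_mod_cast hab')
    have hpow : ∀ i : Fin (d + 1), linearForm ((i : ℕ) : ℂ) ^ d = ∑ l : Fin (d + 1),
        V i l • ((d.choose l : ℂ) • ((X 0 : MvPolynomial (Fin 2) ℂ) ^ (d - l) * X 1 ^ (l : ℕ))) := by
      intro i
      simp only [hV, Matrix.vandermonde_apply]
      rw [linearForm, add_comm, add_pow, Fin.sum_univ_eq_sum_range fun l =>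
        (((i : ℕ) : ℂ) ^ l) • ((d.choose l : ℂ) •
          ((X 0 : MvPolynomial (Fin 2) ℂ) ^ (d - l) * X 1 ^ l))]
      refine sum_congr rfl fun l _ => ?_
      simp only [smul_eq_C_mul, map_natCast, map_pow]
      ring
    have hinv : ∑ i : Fin (d + 1), V⁻¹ ⟨j, by omega⟩ i • linearForm ((i : ℕ) : ℂ) ^ d =
        (d.choose j : ℂ) • ((X 0 : MvPolynomial (Fin 2) ℂ) ^ (d - j) * X 1 ^ j) := by
      simp only [hpow, smul_sum, smul_smul _ (V _ _)]
      rw [sum_comm]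
      simp only [← sum_smul, ← Matrix.mul_apply, Matrix.nonsing_inv_mul V hVu, Matrix.one_apply]
      simp
    have hc : (d.choose j : ℂ) ≠ 0 := by
      exact_mod_cast (Nat.choose_pos hj).ne'
    rw [← inv_smul_smul₀ hc ((X 0 : MvPolynomial (Fin 2) ℂ) ^ (d - j) * X 1 ^ j), ← hinv]
    exact Submodule.smul_mem _ _ (Submodule.sum_mem _ fun i _ =>
      Submodule.smul_mem _ _ (Submodule.subset_span ⟨_, rfl⟩))
  rw [F.as_sum]
  refine Submodule.sum_mem _ fun e he => ?_
  have hdeg : e 0 + e 1 = d := by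
    have := hF (mem_support_iff.mp he)
    simpa [Finsupp.weight_apply, Finsupp.sum_fintype, Fin.sum_univ_two] using this
  have : monomial e (coeff e F) = coeff e F • (X 0 ^ (d - e 1) * X 1 ^ e 1) := by
    rw [monomial_eq, Finsupp.prod_fintype _ _ (by simp), Fin.prod_univ_two, smul_eq_C_mul,
      show d - e 1 = e 0 by omega]
  rw [this]
  exact Submodule.smul_mem _ _ (hmon _ (by omega))

/-- A property of families which is stable under linear combinations in each member holds for
families in the span of `S` as soon as it holds for families in `S`. -/
theorem forall_mem_span_of_update {ι V : Type*} [Fintype ι] [DecidableEq ι] [AddCommMonoid V]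
    [Module ℂ V] (S : Set V) (p : (ι → V) → Prop) (hS : ∀ A, (∀ i, A i ∈ S) → p A)
    (h_zero : ∀ A i, p (Function.update A i 0))
    (h_add : ∀ A i x y, p (Function.update A i x) → p (Function.update A i y) →
      p (Function.update A i (x + y)))
    (h_smul : ∀ A i (c : ℂ) x, p (Function.update A i x) → p (Function.update A i (c • x)))
    (A : ι → V) (hA : ∀ i, A i ∈ Submodule.span ℂ S) : p A := by
  suffices h : ∀ T : Finset ι, ∀ A : ι → V, (∀ i ∈ T, A i ∈ Submodule.span ℂ S) →
      (∀ i ∉ T, A i ∈ S) → p A from h univ A (fun i _ => hA i) fun i hi => (hi (mem_univ i)).elim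
  intro T
  induction T using Finset.induction_on with
  | empty => exact fun A _ h => hS A fun i => h i (by simp)
  | insert a T ha ih =>
    intro A hT hS'
    rw [← Function.update_eq_self a A]
    refine Submodule.span_induction (p := fun x _ => p (Function.update A a x)) (fun x hx => ?_)
      (h_zero A a) (fun x y _ _ => h_add A a x y) (fun c x _ => h_smul A a c x)
      (hT a (mem_insert_self a T))
    refine ih _ (fun i hi => ?_) fun i hi => ?_
    · rw [Function.update_of_ne (by rintro rfl; exact ha hi)]
      exact hT i (mem_insert_of_mem hi)
    · by_cases h : i = a
      · subst h; simpa using hx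
      · rw [Function.update_of_ne h]
        exact hS' i (by simp [h, hi])

theorem isWronskianCombinantCollection_of_linearForm_pow {d r : ℕ}
    {A : Fin r → MvPolynomial (Fin 2) ℂ} {C : ℕ → MvPolynomial (Fin 2) ℂ}
    (hC : ∀ q ∈ Nset r, (C q).IsHomogeneous (r * (d - r + 1) - 2 * q))
    (h : ∀ s : ℂ, wronskian d (Fin.snoc A (linearForm s ^ d) : Fin (r + 1) → _) =
      ∑ q ∈ Nset r,
        transvectant (r * (d - r + 1) - 2 * q) d (r - q) (C q) (linearForm s ^ d)) :
    IsWronskianCombinantCollection d r A C := by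
  refine ⟨hC, fun F hF => ?_⟩
  have hsnoc : ∀ G : MvPolynomial (Fin 2) ℂ, (Fin.snoc A G : Fin (r + 1) → _) =
      Function.update (Fin.snoc A 0 : Fin (r + 1) → MvPolynomial (Fin 2) ℂ) (Fin.last r) G :=
    fun G => (Fin.update_snoc_last ..).symm
  refine Submodule.span_induction (p := fun F _ => wronskian d (Fin.snoc A F : Fin (r + 1) → _) =
      ∑ q ∈ Nset r, transvectant (r * (d - r + 1) - 2 * q) d (r - q) (C q) F) ?_ ?_ ?_ ?_
    (mem_span_linearForm_pow hF)
  · rintro _ ⟨s, rfl⟩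
    exact h s
  · rw [← wronskianMultilinear_apply, hsnoc, MultilinearMap.map_update_zero]
    simp [transvectant_zero_right]
  · intro F G _ _ hF hG
    rw [← wronskianMultilinear_apply, hsnoc] at hF hG ⊢
    rw [MultilinearMap.map_update_add, hF, hG, ← sum_add_distrib]
    simp only [transvectant_add_right]
  · intro c F _ hF
    rw [← wronskianMultilinear_apply, hsnoc] at hF ⊢
    rw [MultilinearMap.map_update_smul, hF, smul_sum]
    simp only [transvectant_smul_right]

theorem exists_collection_linearForm_pow (d r : ℕ) (hr2 : 2 ≤ r) (hrd : r ≤ d - 1)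
    (t : Fin r → ℂ) : ∃ C : ℕ → MvPolynomial (Fin 2) ℂ,
      IsWronskianCombinantCollection d r (fun i => linearForm (t i) ^ d) C := by
  obtain ⟨k, rfl⟩ : ∃ k, r = k + 2 := ⟨r - 2, by omega⟩
  obtain ⟨D, hD, hD1, hDs⟩ := exists_decomposition_prod k (d - (k + 2)) (by omega) t
  obtain ⟨c, hc⟩ := exists_wronskian_linearForm_pow d (k + 2)
  set e : ℕ → ℕ := fun q => (k + 2) * (d - (k + 2) + 1) - 2 * q with he
  refine ⟨fun q => (c * (Matrix.vandermonde t).det *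
    ((e q).factorial / (e q - (k + 2 - q)).factorial)) • D q,
    isWronskianCombinantCollection_of_linearForm_pow (fun q hq => ?_) fun s => ?_⟩
  · exact smul_isHomogeneous (hD q (by simp [Nset] at hq; omega)) _
  · have hsn : (Fin.snoc (fun i => linearForm (t i) ^ d) (linearForm s ^ d) : Fin (k + 2 + 1) → _) =
        fun i => linearForm ((Fin.snoc t s : Fin (k + 2 + 1) → ℂ) i) ^ d := by
      ext1 i
      refine Fin.lastCases ?_ (fun j => ?_) i <;> simp
    have hprod : ∏ i, linearForm ((Fin.snoc t s : Fin (k + 2 + 1) → ℂ) i) ^ (d - (k + 2)) =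
        (∏ i, linearForm (t i) ^ (d - (k + 2))) * linearForm s ^ (d - (k + 2)) := by
      rw [Fin.prod_univ_castSucc]
      simp only [Fin.snoc_castSucc, Fin.snoc_last]
    rw [hsn, hc, det_vandermonde_snoc, hprod]
    rw [← mul_assoc, mul_smul, ← smul_mul_assoc, hDs, Nset, sum_filter, sum_mul, smul_sum]
    refine sum_congr rfl fun q hq => ?_
    have hq : q ≤ k + 2 := by have := mem_range.1 hq; omega
    split_ifs with h1
    · rw [transvectant_smul_left, transvectant_linearForm_pow _ _ _ (by omega), smul_smul,
        show d - (k + 2 - q) = q + (d - (k + 2)) by omega, pow_add]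
      have hf1 : ((e q).factorial : ℂ) ≠ 0 := by exact_mod_cast (e q).factorial_ne_zero
      have hf2 : ((e q - (k + 2 - q)).factorial : ℂ) ≠ 0 := by
        exact_mod_cast (e q - (k + 2 - q)).factorial_ne_zero
      rw [show c * (Matrix.vandermonde t).det *
        ((e q).factorial / (e q - (k + 2 - q)).factorial) *
        ((e q - (k + 2 - q)).factorial / (e q).factorial) = c * (Matrix.vandermonde t).det by
          field_simp]
      congr 1
      ring
    · obtain rfl : q = 1 := by simpa using h1
      simp [hD1]

/-- for `2 ≤ r ≤ d-1` and binary forms `A₁,...,A_r` of order `d`, there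
exists a Wronskian-combinant collection for `(A₁,...,A_r)`. -/
theorem exists_wronskian_combinant_collection (d r : ℕ) (hr2 : 2 ≤ r) (hrd : r ≤ d - 1)
    (A : Fin r → MvPolynomial (Fin 2) ℂ) (hA : ∀ i, (A i).IsHomogeneous d) :
    ∃ C : ℕ → MvPolynomial (Fin 2) ℂ, IsWronskianCombinantCollection d r A C := by
  refine forall_mem_span_of_update (Set.range fun s : ℂ => linearForm s ^ d)
    (fun A => ∃ C : ℕ → MvPolynomial (Fin 2) ℂ, IsWronskianCombinantCollection d r A C)
    ?_ ?_ ?_ ?_ A fun i => mem_span_linearForm_pow (hA i)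
  · intro A hA
    choose t ht using hA
    obtain rfl : (fun i => linearForm (t i) ^ d) = A := funext ht
    exact exists_collection_linearForm_pow d r hr2 hrd t
  · refine fun A i => ⟨0, fun q _ => isHomogeneous_zero _ _ _, fun F _ => ?_⟩
    rw [← wronskianMultilinear_apply, Fin.snoc_update, MultilinearMap.map_update_zero]
    simp [transvectant_zero_left]
  · rintro A i x y ⟨C, hC, hCF⟩ ⟨C', hC', hCF'⟩
    refine ⟨fun q => C q + C' q, fun q hq => (hC q hq).add (hC' q hq), fun F hF => ?_⟩
    have h1 := hCF F hF
    have h2 := hCF' F hF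
    rw [← wronskianMultilinear_apply, Fin.snoc_update] at h1 h2 ⊢
    rw [MultilinearMap.map_update_add, h1, h2, ← sum_add_distrib]
    simp only [transvectant_add_left]
  · rintro A i c x ⟨C, hC, hCF⟩
    refine ⟨fun q => c • C q, fun q hq => smul_isHomogeneous (hC q hq) c, fun F hF => ?_⟩
    have h1 := hCF F hF
    rw [← wronskianMultilinear_apply, Fin.snoc_update] at h1 ⊢
    rw [MultilinearMap.map_update_smul, h1, smul_sum]
    simp only [transvectant_smul_left]
end

section
/- Let d, r be integers with 2 ≤ r ≤ d−1 and let A₁,…,A_r be linearly independent binary forms of order d over ℂ. If (C_q)_{q∈𝒩_r} and (C'_q)_{q∈𝒩_r} are both Wronskian-combinant collections for (A₁,…,A_r), then C_q = C'_q for every q ∈ 𝒩_r; moreover, the member C₀ of any such collection equals the Wronskian W(A₁,…,A_r). -/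
open MvPolynomial Finset

/-- The linear form `-v x₁ + u x₂`, vanishing at the point `(u, v)`. -/
noncomputable def pointForm (u v : ℂ) : MvPolynomial (Fin 2) ℂ :=
  MvPolynomial.C (-v) * X 0 + MvPolynomial.C u * X 1

theorem eval_pointForm (u v : ℂ) : eval ![u, v] (pointForm u v) = 0 := by
  simp [pointForm]; ring

theorem pointForm_ne_zero {u : ℂ} (hu : u ≠ 0) (v : ℂ) : pointForm u v ≠ 0 := by
  intro h
  have h1 := congrArg (eval ![(0 : ℂ), 1]) h
  simp [pointForm] at h1
  exact hu h1

theorem isHomogeneous_pointForm_pow (u v : ℂ) (d : ℕ) :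
    (pointForm u v ^ d).IsHomogeneous d := by
  have h : (pointForm u v).IsHomogeneous 1 :=
    ((isHomogeneous_X ℂ 0).C_mul _).add ((isHomogeneous_X ℂ 1).C_mul _)
  simpa using h.pow d

theorem pderiv_zero_iterate_pointForm (u v c : ℂ) (d i : ℕ) :
    (⇑(pderiv (0 : Fin 2)))^[i] (MvPolynomial.C c * pointForm u v ^ d) =
      MvPolynomial.C ((d.descFactorial i : ℂ) * (-v) ^ i * c) * pointForm u v ^ (d - i) := by
  induction i with
  | zero => simp
  | succ i ih =>
    rw [Function.iterate_succ_apply', ih, Derivation.leibniz, Derivation.leibniz_pow,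
      Nat.descFactorial_succ]
    simp only [pointForm, pderiv_C, map_add, Derivation.leibniz, pderiv_X, smul_eq_mul, nsmul_eq_mul]
    simp [Nat.sub_sub]
    ring

theorem pderiv_one_iterate_pointForm (u v : ℂ) (d i : ℕ) :
    (⇑(pderiv (1 : Fin 2)))^[i] (pointForm u v ^ d) =
      MvPolynomial.C ((d.descFactorial i : ℂ) * u ^ i) * pointForm u v ^ (d - i) := by
  induction i with
  | zero => simp
  | succ i ih =>
    rw [Function.iterate_succ_apply', ih, Derivation.leibniz, Derivation.leibniz_pow,
      Nat.descFactorial_succ]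
    simp only [pointForm, pderiv_C, map_add, Derivation.leibniz, pderiv_X, smul_eq_mul, nsmul_eq_mul]
    simp [Nat.sub_sub]
    ring

theorem pderiv_iterate_pointForm (u v : ℂ) (d i j : ℕ) :
    (⇑(pderiv (0 : Fin 2)))^[i] ((⇑(pderiv (1 : Fin 2)))^[j] (pointForm u v ^ d)) =
      MvPolynomial.C ((d.descFactorial (i + j) : ℂ) * ((-v) ^ i * u ^ j)) *
        pointForm u v ^ (d - (i + j)) := by
  rw [pderiv_one_iterate_pointForm, pderiv_zero_iterate_pointForm, Nat.sub_sub, add_comm j i]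
  congr 2
  have h : d.descFactorial (i + j) = (d - j).descFactorial i * d.descFactorial j := by
    rw [add_comm i j, ← Nat.descFactorial_mul_descFactorial (Nat.le_add_right j i)]
    simp
  rw [h]
  push_cast
  ring

/-- The constant-coefficient derivation `u ∂₁ + v ∂₂`. -/
noncomputable def dirDeriv (u v : ℂ) : Module.End ℂ (MvPolynomial (Fin 2) ℂ) :=
  u • (pderiv (0 : Fin 2)).toLinearMap + v • (pderiv (1 : Fin 2)).toLinearMap

theorem pderiv_zero_one_comm (E : MvPolynomial (Fin 2) ℂ) :
    pderiv (0 : Fin 2) (pderiv (1 : Fin 2) E) = pderiv (1 : Fin 2) (pderiv (0 : Fin 2) E) := by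
  have h : ⁅pderiv (R := ℂ) (0 : Fin 2), pderiv (R := ℂ) (1 : Fin 2)⁆ = 0 := by
    ext i
    fin_cases i <;> simp [Derivation.commutator_apply, pderiv_X]
  have h1 := congrArg (fun D : Derivation ℂ (MvPolynomial (Fin 2) ℂ) (MvPolynomial (Fin 2) ℂ) =>
    D E) h
  simpa [Derivation.commutator_apply, sub_eq_zero] using h1

theorem dirDeriv_pow_apply (u v : ℂ) (k : ℕ) (E : MvPolynomial (Fin 2) ℂ) :
    (dirDeriv u v ^ k) E = ∑ i ∈ Finset.range (k + 1),
      ((k.choose i : ℂ) * (u ^ (k - i) * v ^ i)) •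
        (⇑(pderiv (0 : Fin 2)))^[k - i] ((⇑(pderiv (1 : Fin 2)))^[i] E) := by
  have hc : Commute (v • (pderiv (R := ℂ) (1 : Fin 2)).toLinearMap)
      (u • (pderiv (R := ℂ) (0 : Fin 2)).toLinearMap) := by
    refine Commute.smul_left (Commute.smul_right ?_ u) v
    refine LinearMap.ext fun F => ?_
    exact (pderiv_zero_one_comm F).symm
  rw [dirDeriv, add_comm, hc.add_pow, LinearMap.sum_apply]
  refine Finset.sum_congr rfl fun i _ => ?_
  rw [((hc.pow_pow i (k - i))).eq, (Nat.cast_commute (k.choose i) _).symm.eq, smul_pow, smul_pow]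
  simp only [Module.End.mul_apply, LinearMap.smul_apply, Module.End.natCast_apply, map_smul,
    Module.End.pow_apply, Derivation.coeFn_coe, smul_smul]
  rw [← Nat.cast_smul_eq_nsmul ℂ, smul_smul]
  congr 1
  ring

theorem eval_dirDeriv_pow {e : ℕ} {E : MvPolynomial (Fin 2) ℂ} (hE : E.IsHomogeneous e)
    (u v : ℂ) (k : ℕ) :
    eval ![u, v] ((dirDeriv u v ^ k) E) = (e.descFactorial k : ℂ) * eval ![u, v] E := by
  induction k generalizing e E with
  | zero => simp
  | succ k ih =>
    have hD : (dirDeriv u v E).IsHomogeneous (e - 1) := by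
      simp only [dirDeriv, LinearMap.add_apply, LinearMap.smul_apply, smul_eq_C_mul]
      exact (hE.pderiv.C_mul _).add (hE.pderiv.C_mul _)
    have hEuler : eval ![u, v] (dirDeriv u v E) = e * eval ![u, v] E := by
      have h := congrArg (eval ![u, v]) hE.sum_X_mul_pderiv
      simpa [dirDeriv, Fin.sum_univ_two] using h
    rw [pow_succ, Module.End.mul_apply, ih hD, hEuler]
    rcases e with _ | e
    · simp
    · rw [Nat.succ_descFactorial_succ]
      push_cast [Nat.add_sub_cancel]
      ring

theorem transvectant_pointForm {e d k : ℕ} {E : MvPolynomial (Fin 2) ℂ} (hE : E.IsHomogeneous e)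
    (hke : k ≤ e) (hkd : k ≤ d) (u v : ℂ) :
    ∃ G, transvectant e d k E (pointForm u v ^ d) = pointForm u v ^ (d - k) * G ∧
      eval ![u, v] G = eval ![u, v] E := by
  refine ⟨MvPolynomial.C (((e - k).factorial : ℂ) / (e.factorial : ℂ)) * (dirDeriv u v ^ k) E,
    ?_, ?_⟩
  · have hdf : (d.descFactorial k : ℂ) * ((d - k).factorial : ℂ) = (d.factorial : ℂ) := by
      rw [mul_comm]; exact_mod_cast Nat.factorial_mul_descFactorial hkd
    have hd0 : (d.factorial : ℂ) ≠ 0 := by exact_mod_cast d.factorial_ne_zero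
    have he0 : (e.factorial : ℂ) ≠ 0 := by exact_mod_cast e.factorial_ne_zero
    have hconst : ((((e - k).factorial * (d - k).factorial : ℕ) : ℂ) /
        ((e.factorial * d.factorial : ℕ) : ℂ)) * (d.descFactorial k : ℂ) =
        ((e - k).factorial : ℂ) / (e.factorial : ℂ) := by
      push_cast
      rw [← hdf] at hd0 ⊢
      obtain ⟨h1, h2⟩ := mul_ne_zero_iff.mp hd0
      field_simp
    rw [transvectant, dirDeriv_pow_apply, ← hconst, Finset.smul_sum, Finset.mul_sum,
      Finset.mul_sum]
    refine Finset.sum_congr rfl fun i hi => ?_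
    have hik : i + (k - i) = k := by have := Finset.mem_range.mp hi; omega
    rw [pderiv_iterate_pointForm, hik]
    simp only [smul_eq_C_mul, map_mul, map_pow, map_neg, map_one]
    have hs : (MvPolynomial.C v : MvPolynomial (Fin 2) ℂ) ^ i =
        (-1) ^ i * (-MvPolynomial.C v) ^ i := by
      rw [← mul_pow]; simp
    rw [hs]
    ring
  · rw [map_mul, eval_C, eval_dirDeriv_pow hE]
    have hdf : ((e - k).factorial : ℂ) * (e.descFactorial k : ℂ) = (e.factorial : ℂ) := by
      exact_mod_cast Nat.factorial_mul_descFactorial hke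
    have he0 : (e.factorial : ℂ) ≠ 0 := by exact_mod_cast e.factorial_ne_zero
    rw [← mul_assoc, div_mul_eq_mul_div, hdf, div_self he0, one_mul]

theorem isHomogeneous_iterate_pderiv_s5 {e : ℕ} {E : MvPolynomial (Fin 2) ℂ}
    (hE : E.IsHomogeneous e) (a : Fin 2) (i : ℕ) :
    ((⇑(pderiv a))^[i] E).IsHomogeneous (e - i) := by
  induction i with
  | zero => simpa
  | succ i ih =>
    rw [Function.iterate_succ_apply', ← Nat.sub_sub]
    exact ih.pderiv

/-- A bordered determinant whose last row is orthogonal to consecutive pairs `(u, v)`. -/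
theorem det_bordered {r : ℕ} {u : ℂ} (hu : u ≠ 0) (v : ℂ)
    (M : Matrix (Fin (r + 1)) (Fin (r + 1)) ℂ)
    (hlast : ∀ j : Fin (r + 1), M (Fin.last r) j = (-v) ^ (r - (j : ℕ)) * u ^ (j : ℕ)) :
    M.det = (Matrix.of fun i j : Fin r =>
      u * M i.castSucc j.castSucc + v * M i.castSucc j.succ).det := by
  let U : Matrix (Fin (r + 1)) (Fin (r + 1)) ℂ := Matrix.of fun i j =>
    Fin.lastCases (motive := fun _ => ℂ) (if i = Fin.last r then 1 else 0)
      (fun j => (if i = j.castSucc then u else 0) + (if i = j.succ then v else 0)) j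
  have hU : U.det = u ^ r := by
    rw [Matrix.det_of_isLowerTriangular]
    · rw [Fin.prod_univ_castSucc]
      simp [U, Fin.ext_iff]
    · intro i j hij
      have hij : i < j := hij
      induction j using Fin.lastCases with
      | last => simp [U, hij.ne]
      | cast j =>
        have h1 : i ≠ j.succ := (hij.trans Fin.castSucc_lt_succ).ne
        simp [U, hij.ne, h1]
  have hcol (i : Fin (r + 1)) (j : Fin r) :
      (M * U) i j.castSucc = u * M i j.castSucc + v * M i j.succ := by
    simp [Matrix.mul_apply, U, mul_add, Finset.sum_add_distrib, mul_comm]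
  have hl (i : Fin (r + 1)) : (M * U) i (Fin.last r) = M i (Fin.last r) := by
    simp [Matrix.mul_apply, U]
  have hzero (j : Fin r) : (M * U) (Fin.last r) j.castSucc = 0 := by
    rw [hcol, hlast, hlast]
    have h : r - (j : ℕ) = (r - (j + 1)) + 1 := by omega
    simp only [Fin.val_castSucc, Fin.val_succ]
    rw [h]
    ring
  have hdet : (M * U).det = u ^ r * (Matrix.of fun i j : Fin r =>
      u * M i.castSucc j.castSucc + v * M i.castSucc j.succ).det := by
    rw [Matrix.det_succ_row _ (Fin.last r), Fin.sum_univ_castSucc]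
    simp only [hzero, hl, hlast]
    simp only [mul_zero, zero_mul, Finset.sum_const_zero, zero_add, Fin.val_last, Nat.sub_self,
      pow_zero, one_mul, Even.neg_one_pow ⟨r, rfl⟩]
    congr 2
    ext i j
    simp [hcol]
  rw [Matrix.det_mul, hU, mul_comm] at hdet
  exact mul_left_cancel₀ (pow_ne_zero r hu) hdet

theorem wronskian_snoc_pointForm {d r : ℕ} (hrd : r + 1 ≤ d)
    {A : Fin r → MvPolynomial (Fin 2) ℂ} (hA : ∀ i, (A i).IsHomogeneous d)
    {u : ℂ} (hu : u ≠ 0) (v : ℂ) :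
    ∃ H, wronskian d (Fin.snoc A (pointForm u v ^ d) : Fin (r + 1) → MvPolynomial (Fin 2) ℂ) =
        pointForm u v ^ (d - r) * H ∧
      eval ![u, v] H = eval ![u, v] (wronskian d A) := by
  let M : Matrix (Fin (r + 1)) (Fin (r + 1)) (MvPolynomial (Fin 2) ℂ) := Matrix.of fun i j =>
    Fin.lastCases (motive := fun _ => MvPolynomial (Fin 2) ℂ)
      (MvPolynomial.C ((-v) ^ (r - (j : ℕ)) * u ^ (j : ℕ)))
      (fun i => (⇑(pderiv (0 : Fin 2)))^[r - (j : ℕ)] ((⇑(pderiv (1 : Fin 2)))^[(j : ℕ)] (A i))) i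
  have hd0 : (d.factorial : ℂ) ≠ 0 := by exact_mod_cast d.factorial_ne_zero
  have hdf : ((d - r).factorial : ℂ) * (d.descFactorial r : ℂ) = (d.factorial : ℂ) := by
    exact_mod_cast Nat.factorial_mul_descFactorial (by omega : r ≤ d)
  refine ⟨MvPolynomial.C ((((d - r).factorial : ℂ) / (d.factorial : ℂ)) ^ r) * M.det, ?_, ?_⟩
  · let w : Fin (r + 1) → MvPolynomial (Fin 2) ℂ :=
      Fin.snoc (fun _ => 1) (MvPolynomial.C (d.descFactorial r : ℂ) * pointForm u v ^ (d - r))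
    have hM : (Matrix.of fun i j : Fin (r + 1) =>
        (⇑(pderiv (0 : Fin 2)))^[r + 1 - 1 - (j : ℕ)] ((⇑(pderiv (1 : Fin 2)))^[(j : ℕ)]
          ((Fin.snoc A (pointForm u v ^ d) : Fin (r + 1) → MvPolynomial (Fin 2) ℂ) i))) =
        Matrix.of fun i j => w i * M i j := by
      ext1 i j
      induction i using Fin.lastCases with
      | last =>
        have hj : r - (j : ℕ) + j = r := by omega
        simp only [Matrix.of_apply, Fin.snoc_last, w, M, Fin.lastCases_last, Nat.add_sub_cancel]
        rw [pderiv_iterate_pointForm, hj, map_mul]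
        ring
      | cast i => simp [w, M]
    rw [wronskian, hM, Matrix.det_mul_column, Fin.prod_univ_castSucc]
    have h1 : d - (r + 1) + 1 = d - r := by omega
    have h2 : (((d - r).factorial : ℂ) / (d.factorial : ℂ)) ^ (r + 1) * (d.descFactorial r : ℂ) =
        (((d - r).factorial : ℂ) / (d.factorial : ℂ)) ^ r := by
      rw [pow_succ, mul_assoc, div_mul_eq_mul_div, hdf, div_self hd0, mul_one]
    rw [h1, ← h2, smul_eq_C_mul, map_mul]
    simp only [w, Fin.snoc_castSucc, Fin.snoc_last, Finset.prod_const_one, one_mul]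
    ring
  · rw [wronskian, smul_eq_C_mul, map_mul, map_mul, eval_C, eval_C, RingHom.map_det,
      RingHom.map_det, det_bordered hu v _ (by
        intro j
        simp [M])]
    have hN : (Matrix.of fun i j : Fin r =>
        u * ((eval ![u, v]).mapMatrix M) i.castSucc j.castSucc +
          v * ((eval ![u, v]).mapMatrix M) i.castSucc j.succ) =
        ((d - r + 1 : ℕ) : ℂ) • (eval ![u, v]).mapMatrix (Matrix.of fun i j : Fin r =>
          (⇑(pderiv (0 : Fin 2)))^[r - 1 - (j : ℕ)] ((⇑(pderiv (1 : Fin 2)))^[(j : ℕ)] (A i))) := by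
      ext i j
      have hj := j.isLt
      have hh : ((⇑(pderiv (0 : Fin 2)))^[r - 1 - (j : ℕ)]
          ((⇑(pderiv (1 : Fin 2)))^[(j : ℕ)] (A i))).IsHomogeneous (d - r + 1) := by
        have := isHomogeneous_iterate_pderiv_s5
          (isHomogeneous_iterate_pderiv_s5 (hA i) 1 (j : ℕ)) 0 (r - 1 - (j : ℕ))
        rwa [show d - (j : ℕ) - (r - 1 - (j : ℕ)) = d - r + 1 by omega] at this
      have hE := congrArg (eval ![u, v]) hh.sum_X_mul_pderiv
      have hcomm : pderiv (1 : Fin 2) ((⇑(pderiv (0 : Fin 2)))^[r - 1 - (j : ℕ)]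
          ((⇑(pderiv (1 : Fin 2)))^[(j : ℕ)] (A i))) = (⇑(pderiv (0 : Fin 2)))^[r - 1 - (j : ℕ)]
          ((⇑(pderiv (1 : Fin 2)))^[(j : ℕ) + 1] (A i)) := by
        rw [Function.iterate_succ_apply']
        exact (Function.Commute.iterate_right
          (f := ⇑(pderiv (R := ℂ) (1 : Fin 2))) (fun F => (pderiv_zero_one_comm F).symm) _) _
      rw [Fin.sum_univ_two, hcomm, ← Function.iterate_succ_apply' (⇑(pderiv (0 : Fin 2)))] at hE
      have e1 : (r - 1 - (j : ℕ)).succ = r - j := by omega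
      have e2 : r - 1 - (j : ℕ) = r - (j + 1) := by omega
      rw [e1, e2] at hE
      simpa [M, e2] using hE
    rw [hN, Matrix.det_smul, Fintype.card_fin, ← mul_assoc, ← mul_pow, Nat.factorial_succ]
    congr 2
    push_cast
    ring

theorem eq_of_forall_eval_eq {P Q : MvPolynomial (Fin 2) ℂ}
    (h : ∀ u v : ℂ, u ≠ 0 → eval ![u, v] P = eval ![u, v] Q) : P = Q := by
  refine mul_left_cancel₀ (X_ne_zero (R := ℂ) (0 : Fin 2)) (MvPolynomial.funext fun x => ?_)
  have hx : x = ![x 0, x 1] := by ext i; fin_cases i <;> rfl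
  by_cases h0 : x 0 = 0
  · simp [h0]
  · rw [map_mul, map_mul, hx, h _ _ h0]

/-- Lowest-order term extraction for an expansion in powers of an element vanishing at `x`. -/
theorem eval_eq_zero_of_sum_pow_mul {σ : Type*} {ℓ : MvPolynomial σ ℂ} (hℓ : ℓ ≠ 0) {x : σ → ℂ}
    (hx : eval x ℓ = 0) {s : Finset ℕ} {h : ℕ → MvPolynomial σ ℂ}
    (hsum : ∑ q ∈ s, ℓ ^ q * h q = 0) {q : ℕ} (hq : q ∈ s)
    (hlow : ∀ p ∈ s, p < q → h p = 0) : eval x (h q) = 0 := by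
  have h1 : ℓ ^ q * ∑ p ∈ s, ℓ ^ (p - q) * h p = ℓ ^ q * 0 := by
    rw [mul_zero, ← hsum, Finset.mul_sum]
    refine Finset.sum_congr rfl fun p hp => ?_
    rcases lt_or_ge p q with hpq | hpq
    · simp [hlow p hp hpq]
    · rw [← mul_assoc, ← pow_add, Nat.add_sub_cancel' hpq]
  have h2 := congrArg (eval x) (mul_left_cancel₀ (pow_ne_zero q hℓ) h1)
  rw [map_sum, Finset.sum_eq_single_of_mem q hq] at h2
  · simpa using h2
  · intro p hp hne
    rcases lt_or_gt_of_ne hne with hpq | hpq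
    · simp [hlow p hp hpq]
    · simp [hx, Nat.sub_ne_zero_of_lt hpq]

/-- Evaluating a collection on a power of a linear form. -/
theorem IsWronskianCombinantCollection.expansion {d r : ℕ} (hrd : r + 1 ≤ d)
    {A : Fin r → MvPolynomial (Fin 2) ℂ} {C : ℕ → MvPolynomial (Fin 2) ℂ}
    (hC : IsWronskianCombinantCollection d r A C) {u : ℂ} (hu : u ≠ 0) (v : ℂ)
    {H : MvPolynomial (Fin 2) ℂ}
    (hH : wronskian d (Fin.snoc A (pointForm u v ^ d) : Fin (r + 1) → MvPolynomial (Fin 2) ℂ) =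
      pointForm u v ^ (d - r) * H) :
    ∃ G : ℕ → MvPolynomial (Fin 2) ℂ, H = ∑ q ∈ Nset r, pointForm u v ^ q * G q ∧
      ∀ q ∈ Nset r,
        transvectant (r * (d - r + 1) - 2 * q) d (r - q) (C q) (pointForm u v ^ d) =
          pointForm u v ^ (d - (r - q)) * G q ∧
        eval ![u, v] (G q) = eval ![u, v] (C q) := by
  have hex : ∀ q, ∃ G, q ∈ Nset r →
      transvectant (r * (d - r + 1) - 2 * q) d (r - q) (C q) (pointForm u v ^ d) =
        pointForm u v ^ (d - (r - q)) * G ∧ eval ![u, v] G = eval ![u, v] (C q) := by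
    intro q
    by_cases hq : q ∈ Nset r
    · have hqr : q ≤ r := by simp [Nset] at hq; omega
      have hm : r * 2 ≤ r * (d - r + 1) := Nat.mul_le_mul_left r (by omega)
      obtain ⟨G, hG⟩ := transvectant_pointForm (hC.1 q hq)
        (by omega : r - q ≤ _) (by omega : r - q ≤ d) u v
      exact ⟨G, fun _ => hG⟩
    · exact ⟨0, fun h => absurd h hq⟩
  choose G hG using hex
  refine ⟨G, ?_, hG⟩
  refine mul_left_cancel₀ (pow_ne_zero (d - r) (pointForm_ne_zero hu v)) ?_
  rw [← hH, hC.2 _ (isHomogeneous_pointForm_pow u v d), Finset.mul_sum]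
  refine Finset.sum_congr rfl fun q hq => ?_
  have hqr : q ≤ r := by simp [Nset] at hq; omega
  rw [(hG q hq).1, ← mul_assoc, ← pow_add]
  congr 2
  omega

/-- for linearly independent binary forms `A₁,...,A_r` of order `d`
(`2 ≤ r ≤ d-1`), any two Wronskian-combinant collections coincide on `𝒩_r`, and the
member `C₀` equals the Wronskian `W(A₁,...,A_r)`. -/
theorem wronskian_combinant_collection_unique (d r : ℕ) (hr2 : 2 ≤ r) (hrd : r ≤ d - 1)
    (A : Fin r → MvPolynomial (Fin 2) ℂ) (hA : ∀ i, (A i).IsHomogeneous d)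
    (hind : LinearIndependent ℂ A)
    (C C' : ℕ → MvPolynomial (Fin 2) ℂ)
    (hC : IsWronskianCombinantCollection d r A C)
    (hC' : IsWronskianCombinantCollection d r A C') :
    (∀ q ∈ Nset r, C q = C' q) ∧ C 0 = wronskian d A := by
  have hrd' : r + 1 ≤ d := by omega
  constructor
  · intro q
    induction q using Nat.strong_induction_on with
    | _ q ih =>
      intro hq
      refine eq_of_forall_eval_eq fun u v hu => ?_
      have hl := pointForm_ne_zero hu v
      obtain ⟨H, hH, -⟩ := wronskian_snoc_pointForm hrd' hA hu v
      obtain ⟨G, hG, hGC⟩ := hC.expansion hrd' hu v hH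
      obtain ⟨G', hG', hGC'⟩ := hC'.expansion hrd' hu v hH
      have h0 := eval_eq_zero_of_sum_pow_mul (h := fun q => G q - G' q) hl (eval_pointForm u v)
        (s := Nset r) (by simp [mul_sub, ← hG, ← hG']) hq (by
          intro p hp hpq
          refine sub_eq_zero.mpr (mul_left_cancel₀ (pow_ne_zero (d - (r - p)) hl) ?_)
          rw [← (hGC p hp).1, ← (hGC' p hp).1, ih p hpq hp])
      rw [map_sub, (hGC q hq).2, (hGC' q hq).2] at h0
      exact sub_eq_zero.mp h0
  · refine eq_of_forall_eval_eq fun u v hu => ?_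
    obtain ⟨H, hH, hHW⟩ := wronskian_snoc_pointForm hrd' hA hu v
    obtain ⟨G, hG, hGC⟩ := hC.expansion hrd' hu v hH
    have h0 : 0 ∈ Nset r := by simp [Nset]
    rw [← hHW, ← (hGC 0 h0).2, hG, map_sum, Finset.sum_eq_single_of_mem 0 h0]
    · simp
    · intro q _ hq
      simp [eval_pointForm, hq]
end

section
/- Let d, r be integers with 2 ≤ r ≤ d−1, let A₁,…,A_r be linearly independent binary forms of order d over ℂ, and let (C_q)_{q∈𝒩_r} be a Wronskian-combinant collection for (A₁,…,A_r). Then a binary form F of order d satisfies Σ_{q∈𝒩_r} (C_q, F)_{r−q} = 0 if and only if F lies in the ℂ-linear span of A₁,…,A_r. -/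
open MvPolynomial Finset

theorem iterate_pderiv_monomial {σ R : Type*} [CommSemiring R] (i : σ) (k : ℕ) (s : σ →₀ ℕ)
    (c : R) :
    (⇑(pderiv i))^[k] (monomial s c) =
      monomial (s - Finsupp.single i k) (c * ((s i).descFactorial k : R)) := by
  classical
  induction k with
  | zero => simp
  | succ k ih =>
    rw [Function.iterate_succ_apply', ih, pderiv_monomial, tsub_tsub, ← Finsupp.single_add,
      Nat.descFactorial_succ]
    simp only [Finsupp.coe_tsub, Pi.sub_apply, Finsupp.single_eq_same]
    push_cast
    ring_nf

theorem map_iterate_pderiv_sum {σ R ι : Type*} [CommSemiring R] (i : σ) (k : ℕ) (t : Finset ι)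
    (f : ι → MvPolynomial σ R) :
    (⇑(pderiv i))^[k] (∑ x ∈ t, f x) = ∑ x ∈ t, (⇑(pderiv i))^[k] (f x) := by
  have h : ∀ p : MvPolynomial σ R, (⇑(pderiv i))^[k] p = ((pderiv i).toLinearMap ^ k) p := by
    intro p
    rw [Module.End.pow_apply]
    rfl
  simp only [h, map_sum]

theorem iterate_pderiv_smul {σ R : Type*} [CommSemiring R] (i : σ) (k : ℕ) (c : R)
    (p : MvPolynomial σ R) :
    (⇑(pderiv i))^[k] (c • p) = c • (⇑(pderiv i))^[k] p := by
  induction k with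
  | zero => rfl
  | succ k ih =>
    rw [Function.iterate_succ_apply', ih, Derivation.map_smul, Function.iterate_succ_apply']

/-- The dehomogenization `x₁ ↦ 1`, `x₂ ↦ X`. -/
noncomputable def dehomogenize : MvPolynomial (Fin 2) ℂ →ₐ[ℂ] Polynomial ℂ :=
  aeval ![1, Polynomial.X]

theorem coeff_X_pow_mul_dehomogenize_monomial (a j m : ℕ) (u : Fin 2 →₀ ℕ) (c : ℂ) :
    (Polynomial.X ^ j * dehomogenize ((⇑(pderiv (0 : Fin 2)))^[a]
      ((⇑(pderiv (1 : Fin 2)))^[j] (monomial u c)))).coeff m =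
      if m = u 1 then ((u 0).descFactorial a : ℂ) * ((u 1).descFactorial j : ℂ) * c else 0 := by
  rw [iterate_pderiv_monomial, iterate_pderiv_monomial, dehomogenize, aeval_monomial,
    Finsupp.prod_fintype _ _ (by simp)]
  simp only [Fin.prod_univ_two, Finsupp.coe_tsub, Pi.sub_apply]
  by_cases hj : j ≤ u 1
  · have : (Polynomial.X : Polynomial ℂ) ^ u 1 = Polynomial.X ^ j * Polynomial.X ^ (u 1 - j) := by
      rw [← pow_add, Nat.add_sub_cancel' hj]
    have h2 : ∀ z : Polynomial ℂ, Polynomial.X ^ j * (z * Polynomial.X ^ (u 1 - j)) =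
        z * Polynomial.X ^ u 1 := by
      intro z; rw [this]; ring
    simp [h2, Polynomial.coeff_C_mul, Polynomial.coeff_X_pow,
      -map_mul, -map_natCast, Polynomial.algebraMap_eq]
    exact if_congr Iff.rfl (by ring) rfl
  · simp [Nat.descFactorial_eq_zero_iff_lt.2 (not_le.1 hj)]

theorem coeff_X_pow_mul_dehomogenize_eq_sum (F : MvPolynomial (Fin 2) ℂ) (a j m : ℕ) :
    (Polynomial.X ^ j * dehomogenize ((⇑(pderiv (0 : Fin 2)))^[a]
      ((⇑(pderiv (1 : Fin 2)))^[j] F))).coeff m = ∑ u ∈ F.support,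
      if m = u 1 then ((u 0).descFactorial a : ℂ) * ((u 1).descFactorial j : ℂ) * coeff u F
      else 0 := by
  conv_lhs => rw [F.as_sum]
  simp only [map_iterate_pderiv_sum, map_sum, Finset.mul_sum, Polynomial.finsetSum_coeff,
    coeff_X_pow_mul_dehomogenize_monomial]

theorem coeff_dehomogenize (F : MvPolynomial (Fin 2) ℂ) (m : ℕ) :
    (dehomogenize F).coeff m = ∑ u ∈ F.support, if m = u 1 then coeff u F else 0 := by
  simpa using coeff_X_pow_mul_dehomogenize_eq_sum F 0 0 m

theorem add_eq_of_mem_support {d : ℕ} {F : MvPolynomial (Fin 2) ℂ} (hF : F.IsHomogeneous d)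
    {u : Fin 2 →₀ ℕ} (hu : u ∈ F.support) : u 0 + u 1 = d := by
  have := hF (mem_support_iff.1 hu)
  rw [Finsupp.weight_apply, Finsupp.sum_fintype _ _ (by simp)] at this
  simpa using this

theorem coeff_X_pow_mul_dehomogenize {d : ℕ} {F : MvPolynomial (Fin 2) ℂ}
    (hF : F.IsHomogeneous d) (a j m : ℕ) :
    (Polynomial.X ^ j * dehomogenize ((⇑(pderiv (0 : Fin 2)))^[a]
      ((⇑(pderiv (1 : Fin 2)))^[j] F))).coeff m =
      ((d - m).descFactorial a : ℂ) * (m.descFactorial j : ℂ) * (dehomogenize F).coeff m := by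
  rw [coeff_X_pow_mul_dehomogenize_eq_sum, coeff_dehomogenize, Finset.mul_sum]
  refine Finset.sum_congr rfl fun u hu => ?_
  split_ifs with h
  · rw [h, ← add_eq_of_mem_support hF hu, Nat.add_sub_cancel]
  · simp

theorem coeff_dehomogenize_of_lt {d m : ℕ} {F : MvPolynomial (Fin 2) ℂ}
    (hF : F.IsHomogeneous d) (hm : d < m) : (dehomogenize F).coeff m = 0 := by
  rw [coeff_dehomogenize]
  refine Finset.sum_eq_zero fun u hu => if_neg ?_
  have := add_eq_of_mem_support hF hu
  omega

theorem eq_zero_of_dehomogenize_eq_zero {d : ℕ} {F : MvPolynomial (Fin 2) ℂ}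
    (hF : F.IsHomogeneous d) (h : dehomogenize F = 0) : F = 0 := by
  by_contra hne
  obtain ⟨u, hu⟩ := support_nonempty.2 hne
  have hc := coeff_dehomogenize F (u 1)
  rw [h, Polynomial.coeff_zero, Finset.sum_eq_single_of_mem u hu, if_pos rfl] at hc
  · exact mem_support_iff.1 hu hc.symm
  · intro w hw hwu
    refine if_neg fun h1 => hwu (Finsupp.ext fun i => ?_)
    have h2 := add_eq_of_mem_support hF hu
    have h3 := add_eq_of_mem_support hF hw
    fin_cases i <;> simp <;> omega

theorem coeff_mul_add_of_forall_lt {R : Type*} [Semiring R] {p q : Polynomial R} {k m : ℕ}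
    (hp : ∀ i < k, p.coeff i = 0) (hq : ∀ i < m, q.coeff i = 0) :
    (p * q).coeff (k + m) = p.coeff k * q.coeff m := by
  rw [Polynomial.coeff_mul]
  refine Finset.sum_eq_single_of_mem (k, m) (by simp) ?_
  rintro ⟨x, y⟩ hxy hne
  rw [Finset.HasAntidiagonal.mem_antidiagonal] at hxy
  rcases lt_trichotomy x k with h | h | h
  · simp [hp x h]
  · exact absurd (by ext <;> simp_all) hne
  · have h' : y < m := by simp at hxy; omega
    simp [hq y h']

/-- The indicial polynomial `∑ⱼ cⱼ (d - X)_{s-1-j} (X)_j` written with falling factorials. -/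
noncomputable def indicialPolynomial (d : ℕ) {s : ℕ} (c : Fin s → ℂ) : Polynomial ℂ :=
  ∑ j : Fin s, Polynomial.C (c j) *
    ((descPochhammer ℂ (s - 1 - j)).comp (Polynomial.C (d : ℂ) - Polynomial.X) *
      descPochhammer ℂ j)

theorem eval_indicialPolynomial {d m s : ℕ} (hm : m ≤ d) (c : Fin s → ℂ) :
    (indicialPolynomial d c).eval (m : ℂ) = ∑ j : Fin s, c j *
      (((d - m).descFactorial (s - 1 - j) : ℂ) * (m.descFactorial j : ℂ)) := by
  simp [indicialPolynomial, Polynomial.eval_finsetSum, ← Nat.cast_sub hm,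
    descPochhammer_eval_eq_descFactorial]

theorem degree_indicialPolynomial_lt (d : ℕ) {s : ℕ} (c : Fin s → ℂ) :
    (indicialPolynomial d c).degree < s := by
  refine (Polynomial.degree_sum_le _ _).trans_lt ?_
  rw [Finset.sup_lt_iff (WithBot.bot_lt_coe _)]
  intro j _
  have hX : (Polynomial.C (d : ℂ) - Polynomial.X).natDegree = 1 := by
    rw [← Polynomial.natDegree_neg, neg_sub, Polynomial.natDegree_X_sub_C]
  refine Polynomial.degree_le_natDegree.trans_lt (Nat.cast_lt.2 ?_)
  refine (Polynomial.natDegree_C_mul_le _ _).trans_lt (Polynomial.natDegree_mul_le.trans_lt ?_)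
  rw [Polynomial.natDegree_comp, hX, descPochhammer_natDegree, descPochhammer_natDegree]
  omega

theorem indicialPolynomial_ne_zero {d s : ℕ} (hs : s ≤ d + 1) {c : Fin s → ℂ} (hc : c ≠ 0) :
    indicialPolynomial d c ≠ 0 := by
  intro h
  apply hc
  funext k
  obtain ⟨k, hk⟩ := k
  induction k using Nat.strong_induction_on with
  | _ k ih =>
    have hev := eval_indicialPolynomial (d := d) (m := k) (by omega) c
    rw [h, Polynomial.eval_zero, Finset.sum_eq_single (⟨k, hk⟩ : Fin s)] at hev
    · have h1 : ((d - k).descFactorial (s - 1 - k) : ℂ) ≠ 0 := by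
        rw [Nat.cast_ne_zero, Ne, Nat.descFactorial_eq_zero_iff_lt]
        omega
      have h2 : (k.descFactorial k : ℂ) ≠ 0 := by
        rw [Nat.cast_ne_zero, Ne, Nat.descFactorial_eq_zero_iff_lt]
        omega
      simpa [h1, h2] using hev.symm
    · rintro ⟨j, hj⟩ _ hne
      rcases lt_or_gt_of_ne (fun e : j = k => hne (by simp [e])) with hlt | hlt
      · rw [ih j hlt hj]; simp
      · simp [Nat.descFactorial_eq_zero_iff_lt.2 hlt]
    · simp

theorem det_ne_zero_of_coeff_eq {d s : ℕ} (hs : s ≤ d + 1) {f : Fin s → Polynomial ℂ}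
    (hf : LinearIndependent ℂ f) (hfd : ∀ i m, d < m → (f i).coeff m = 0)
    {N : Matrix (Fin s) (Fin s) (Polynomial ℂ)}
    (hN : ∀ i j m, (N i j).coeff m =
      ((d - m).descFactorial (s - 1 - j) : ℂ) * (m.descFactorial j : ℂ) * (f i).coeff m) :
    N.det ≠ 0 := by
  classical
  intro hdet
  obtain ⟨v, hv0, hv⟩ := Matrix.exists_mulVec_eq_zero_iff.2 hdet
  have hex : ∃ k, ∃ j, (v j).coeff k ≠ 0 := by
    by_contra! hcon
    exact hv0 (funext fun j => Polynomial.ext fun k => by simpa using hcon k j)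
  set k := Nat.find hex
  have hlow : ∀ j, ∀ i < k, (v j).coeff i = 0 := fun j i hi => by
    have := Nat.find_min hex hi
    push Not at this
    exact this j
  set c : Fin s → ℂ := fun j => (v j).coeff k
  have hc : c ≠ 0 := by
    obtain ⟨j, hj⟩ := Nat.find_spec hex
    exact fun h => hj (congrFun h j)
  set R : Finset ℕ := (Finset.range (d + 1)).filter
    fun m => (indicialPolynomial d c).eval (m : ℂ) = 0 with hR
  have hcard : R.card < s := by
    by_contra! hge
    refine indicialPolynomial_ne_zero hs hc
      (Polynomial.eq_zero_of_degree_lt_of_eval_finset_eq_zero (R.map Nat.castEmbedding) ?_ ?_)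
    · rw [Finset.card_map]
      exact (degree_indicialPolynomial_lt d c).trans_le (by exact_mod_cast hge)
    · intro x hx
      obtain ⟨m, hm, rfl⟩ := Finset.mem_map.1 hx
      exact (Finset.mem_filter.1 hm).2
  let L : (Fin s → ℂ) →ₗ[ℂ] (R → ℂ) :=
    LinearMap.pi fun m => (Polynomial.lcoeff ℂ (m : ℕ)).comp (Fintype.linearCombination ℂ f)
  have hLker : LinearMap.ker L ≠ ⊥ := by
    apply LinearMap.ker_ne_bot_of_finrank_lt
    simpa using hcard
  obtain ⟨g, hgL, hg0⟩ := (Submodule.ne_bot_iff _).1 hLker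
  set p : Polynomial ℂ := ∑ i, g i • f i with hp
  have hp0 : p ≠ 0 := fun h => hg0 (funext (Fintype.linearIndependent_iff.1 hf g h))
  set m := p.natTrailingDegree
  have hpm : p.coeff m ≠ 0 := Polynomial.trailingCoeff_nonzero_iff_nonzero.2 hp0
  have hmd : m ≤ d := by
    by_contra! h
    exact hpm (by simp [hp, Polynomial.finsetSum_coeff, hfd _ _ h])
  have hcoef : ∀ j n, (∑ i, g i • N i j).coeff n =
      ((d - n).descFactorial (s - 1 - j) : ℂ) * (n.descFactorial j : ℂ) * p.coeff n := by
    intro j n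
    simp only [hp, Polynomial.finsetSum_coeff, Polynomial.coeff_smul, hN, smul_eq_mul,
      Finset.mul_sum]
    exact Finset.sum_congr rfl fun i _ => by ring
  have hrel : ∑ j, v j * ∑ i, g i • N i j = 0 := by
    have : ∑ i, g i • ∑ j, N i j * v j = 0 :=
      Finset.sum_eq_zero fun i _ => by
        have := congrFun hv i
        rw [Matrix.mulVec, dotProduct] at this
        rw [this]; simp
    rw [← this]
    simp only [Finset.mul_sum, Finset.smul_sum]
    rw [Finset.sum_comm]
    exact Finset.sum_congr rfl fun i _ => Finset.sum_congr rfl fun j _ => by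
      rw [mul_smul_comm, mul_comm]
  have hzero : (indicialPolynomial d c).eval (m : ℂ) * p.coeff m = 0 := by
    have h := congrArg (fun q => Polynomial.coeff q (k + m)) hrel
    simp only [Polynomial.finsetSum_coeff, Polynomial.coeff_zero] at h
    rw [eval_indicialPolynomial hmd, Finset.sum_mul, ← h]
    refine Finset.sum_congr rfl fun j _ => ?_
    rw [coeff_mul_add_of_forall_lt (hlow j), hcoef]
    · ring
    · intro i hi
      rw [hcoef, Polynomial.coeff_eq_zero_of_lt_natTrailingDegree hi, mul_zero]
  have hmR : m ∈ R := by
    simp only [hR, Finset.mem_filter, Finset.mem_range]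
    exact ⟨by omega, (mul_eq_zero.1 hzero).resolve_right hpm⟩
  apply hpm
  have := congrFun (LinearMap.mem_ker.1 hgL) ⟨m, hmR⟩
  simpa [L, hp, Fintype.linearCombination_apply, Polynomial.finsetSum_coeff] using this

theorem wronskian_ne_zero {d s : ℕ} (hs : s ≤ d + 1) {B : Fin s → MvPolynomial (Fin 2) ℂ}
    (hB : ∀ i, (B i).IsHomogeneous d) (hind : LinearIndependent ℂ B) : wronskian d B ≠ 0 := by
  have hf : LinearIndependent ℂ fun i => dehomogenize (B i) := by
    rw [Fintype.linearIndependent_iff] at hind ⊢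
    intro g hg
    refine hind g (eq_zero_of_dehomogenize_eq_zero (d := d) ?_ (by simpa using hg))
    refine IsHomogeneous.sum _ _ _ fun i _ => ?_
    rw [smul_eq_C_mul]
    simpa using (isHomogeneous_C _ (g i)).mul (hB i)
  have hdet := det_ne_zero_of_coeff_eq hs hf (fun i m hm => coeff_dehomogenize_of_lt (hB i) hm)
    (N := Matrix.of fun i j => Polynomial.X ^ (j : ℕ) *
      (Matrix.of fun i j : Fin s => dehomogenize ((⇑(pderiv (0 : Fin 2)))^[s - 1 - (j : ℕ)]
        ((⇑(pderiv (1 : Fin 2)))^[(j : ℕ)] (B i)))) i j)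
    (fun i j m => coeff_X_pow_mul_dehomogenize (hB i) _ _ m)
  rw [Matrix.det_mul_row] at hdet
  refine smul_ne_zero (pow_ne_zero _ (div_ne_zero ?_ ?_)) fun h => right_ne_zero_of_mul hdet ?_
  · exact_mod_cast Nat.factorial_ne_zero _
  · exact_mod_cast Nat.factorial_ne_zero _
  · have := congrArg dehomogenize h
    rwa [map_zero, AlgHom.map_det] at this

theorem wronskian_eq_zero {d s : ℕ} {B : Fin s → MvPolynomial (Fin 2) ℂ}
    (hB : ¬ LinearIndependent ℂ B) : wronskian d B = 0 := by
  obtain ⟨g, hg, i, hi⟩ := Fintype.not_linearIndependent_iff.1 hB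
  rw [wronskian, Matrix.exists_vecMul_eq_zero_iff.1, smul_zero]
  refine ⟨fun i => C (g i), fun h => hi (by simpa using congrFun h i), ?_⟩
  funext j
  simp only [Matrix.vecMul, dotProduct, Matrix.of_apply, ← smul_eq_C_mul, ← iterate_pderiv_smul,
    ← map_iterate_pderiv_sum, hg]
  simp

/-- for linearly independent binary forms `A₁,...,A_r` of order `d`
(`2 ≤ r ≤ d-1`) with Wronskian-combinant collection `(C_q)`, a binary form `F` of
order `d` satisfies `Σ_q (C_q, F)_(r-q) = 0` iff `F` lies in the span of the `A_i`. -/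
theorem solution_iff_mem_span (d r : ℕ) (hr2 : 2 ≤ r) (hrd : r ≤ d - 1)
    (A : Fin r → MvPolynomial (Fin 2) ℂ) (hA : ∀ i, (A i).IsHomogeneous d)
    (hind : LinearIndependent ℂ A)
    (C : ℕ → MvPolynomial (Fin 2) ℂ) (hC : IsWronskianCombinantCollection d r A C)
    (F : MvPolynomial (Fin 2) ℂ) (hF : F.IsHomogeneous d) :
    (∑ q ∈ Nset r, transvectant (r * (d - r + 1) - 2 * q) d (r - q) (C q) F = 0) ↔
      F ∈ Submodule.span ℂ (Set.range A) := by
  rw [← hC.2 F hF]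
  have hhom : ∀ i, (Fin.snoc A F : Fin (r + 1) → MvPolynomial (Fin 2) ℂ) i |>.IsHomogeneous d :=
    Fin.lastCases (by simpa using hF) fun i => by simpa using hA i
  have hsnoc : LinearIndependent ℂ (Fin.snoc A F : Fin (r + 1) → MvPolynomial (Fin 2) ℂ) ↔
      F ∉ Submodule.span ℂ (Set.range A) := by
    simp [linearIndependent_finSnoc, hind]
  constructor
  · contrapose!
    exact fun h => wronskian_ne_zero (by omega) hhom (hsnoc.2 h)
  · exact fun h => wronskian_eq_zero fun hli => hsnoc.1 hli h
end
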